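/- Let A and B be connected ℕ-graded k-algebras such that A ⊗_k B is noetherian. Then the following are equivalent: (i) A ⊗_k B, as a ℤ²-graded algebra, satisfies the ε-condition; (ii) A ⊗_k B, as a ℤ-graded algebra via total degree, satisfies the ε-condition; (iii) both A and B satisfy the ε-condition. In particular, A satisfies the ε-condition if and only if the polynomial extension A[t] does. -/

import Mathlib

open CategoryTheory

/-- An ε-object over an `ι`-graded algebra `A` (where `ι ≅ ℤ^w`): a bounded complex
of finitely generated projective graded left `A`-modules (with grade-preserving
differentials) all of whose cohomology modules are finite dimensional over `k`.
(Every perfect complex of graded modules with finite-dimensional cohomology is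
isomorphic in the derived category to such a complex, and conversely.) -/
structure EpsObject (k : Type) [Field k] (A : Type) [Ring A] [Algebra k A]
    {ι : Type} [AddCommGroup ι] [DecidableEq ι] (𝒜 : ι → Submodule k A) where
  X : CochainComplex (ModuleCat.{0} A) ℤ
  bounded : ∃ N : ℕ, ∀ n : ℤ, (N : ℤ) < |n| → Limits.IsZero (X.X n)
  proj : ∀ n : ℤ, Projective (X.X n)
  fg : ∀ n : ℤ, Module.Finite A (X.X n)
  gr : ∀ n : ℤ, ι → AddSubgroup (X.X n)
  internal : ∀ n : ℤ, DirectSum.IsInternal (gr n)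
  smul_mem : ∀ (n : ℤ) (i j : ι) (a : A) (m : X.X n),
    a ∈ 𝒜 i → m ∈ gr n j → a • m ∈ gr n (i + j)
  d_mem : ∀ (n : ℤ) (i : ι) (m : X.X n), m ∈ gr n i → X.d n (n + 1) m ∈ gr (n + 1) i
  findim : ∀ n : ℤ, FiniteDimensional k
    ((ModuleCat.restrictScalars (algebraMap k A)).obj (X.homology n))

/-- A graded algebra `A` satisfies the ε-condition if the category `D_ε(A)` of
perfect complexes of graded `A`-modules with finite-dimensional cohomology is
nonzero, i.e. there is an ε-object which is nonzero in the derived category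
(equivalently, has some nonvanishing cohomology). -/
def EpsCondition (k : Type) [Field k] (A : Type) [Ring A] [Algebra k A]
    {ι : Type} [AddCommGroup ι] [DecidableEq ι] (𝒜 : ι → Submodule k A) : Prop :=
  ∃ E : EpsObject k A 𝒜, ∃ n : ℤ, ¬ Limits.IsZero (E.X.homology n)


namespace EpsAux

/-- Elementwise finite-dimensionality of `ker g / im f`. -/
def FinH (k : Type) [Field k] {A : Type} [Ring A] [Algebra k A] {M' M M'' : Type}
    [AddCommGroup M'] [AddCommGroup M] [AddCommGroup M''] [Module A M'] [Module A M]
    [Module A M''] (f : M' →ₗ[A] M) (g : M →ₗ[A] M'') : Prop :=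
  ∃ (r : ℕ) (w : Fin r → M), ∀ z, g z = 0 →
    ∃ (c : Fin r → k) (y : M'), z = ∑ i, algebraMap k A (c i) • w i + f y

section
variable {k : Type} [Field k] {A : Type} [Ring A] [Algebra k A] {M' M M'' H : Type}
    [AddCommGroup M'] [AddCommGroup M] [AddCommGroup M''] [Module A M'] [Module A M]
    [Module A M''] {f : M' →ₗ[A] M} {g : M →ₗ[A] M''}

theorem FinH.cycles (h : FinH k f g) :
    ∃ (r : ℕ) (w : Fin r → M), (∀ i, g (w i) = 0) ∧ ∀ z, g z = 0 →
    ∃ (c : Fin r → k) (y : M'), z = ∑ i, algebraMap k A (c i) • w i + f y := by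
  obtain ⟨r, w, hw⟩ := h
  let P : Submodule k (Fin r → k) :=
    { carrier := {c | ∃ y, g (∑ i, algebraMap k A (c i) • w i + f y) = 0}
      zero_mem' := ⟨0, by simp⟩
      add_mem' := by
        rintro c c' ⟨y, hy⟩ ⟨y', hy'⟩
        refine ⟨y + y', ?_⟩
        have := congrArg₂ (· + ·) hy hy'
        simp only [← map_add, add_zero] at this
        rw [← this]
        congr 1
        simp [add_smul, Finset.sum_add_distrib]
        abel
      smul_mem' := by
        rintro e c ⟨y, hy⟩
        refine ⟨algebraMap k A e • y, ?_⟩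
        have := congrArg (algebraMap k A e • ·) hy
        simp only [← map_smul, smul_zero] at this
        rw [← this]
        congr 1
        simp [smul_add, Finset.smul_sum, smul_smul] }
  obtain ⟨s, b, hb⟩ := Module.Finite.exists_fin (R := k) (M := P)
  choose y hy using fun j => (b j).2
  refine ⟨s, fun j => ∑ i, algebraMap k A ((b j).1 i) • w i + f (y j), hy, ?_⟩
  intro z hz
  obtain ⟨c, y0, hc⟩ := hw z hz
  have hcP : c ∈ P := ⟨y0, by rw [← hc, hz]⟩
  have : (⟨c, hcP⟩ : P) ∈ Submodule.span k (Set.range b) := by rw [hb]; trivial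
  rw [Submodule.mem_span_range_iff_exists_fun] at this
  obtain ⟨e, he⟩ := this
  refine ⟨e, y0 - ∑ j, algebraMap k A (e j) • y j, ?_⟩
  have he' : ∀ i, c i = ∑ j, e j * (b j).1 i := by
    intro i
    have := congrFun (congrArg Subtype.val he) i
    simpa using this.symm
  rw [hc]
  simp only [he', smul_add, Finset.sum_add_distrib, map_sub, map_sum, map_smul, map_mul,
    Finset.smul_sum, Finset.sum_smul, smul_smul]
  rw [Finset.sum_comm]
  abel

theorem fd_iff (H : ModuleCat.{0} A) (q : LinearMap.ker g →ₗ[A] H)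
    (hq : Function.Surjective q) (hq0 : ∀ z, q z = 0 ↔ ∃ y, f y = z.1) :
    FiniteDimensional k ((ModuleCat.restrictScalars (algebraMap k A)).obj H) ↔
      FinH k f g := by
  constructor
  · intro h
    obtain ⟨r, s, hs⟩ := Module.Finite.exists_fin (R := k)
      (M := ((ModuleCat.restrictScalars (algebraMap k A)).obj H))
    choose w hw using fun i => hq (s i)
    refine ⟨r, fun i => (w i).1, fun z hz => ?_⟩
    let zz : LinearMap.ker g := ⟨z, hz⟩
    have : (show ((ModuleCat.restrictScalars (algebraMap k A)).obj H) from q zz) ∈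
      Submodule.span k (Set.range s) := by rw [hs]; trivial
    rw [Submodule.mem_span_range_iff_exists_fun] at this
    obtain ⟨c, hc⟩ := this
    have hc' : ∑ i, algebraMap k A (c i) • q (w i) = q zz := by
      refine Eq.trans ?_ hc
      refine Finset.sum_congr rfl fun i _ => ?_
      rw [hw]; rfl
    have : q (zz - ∑ i, algebraMap k A (c i) • w i) = 0 := by
      rw [map_sub, map_sum, sub_eq_zero, ← hc']
      simp
    obtain ⟨y, hy⟩ := (hq0 _).1 this
    refine ⟨c, y, ?_⟩
    rw [hy]
    simp [zz]
  · intro h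
    obtain ⟨r, w, hw0, hw⟩ := h.cycles
    classical
    refine ⟨⟨Finset.univ.image (fun i => (show ((ModuleCat.restrictScalars
      (algebraMap k A)).obj H) from q ⟨w i, hw0 i⟩)), ?_⟩⟩
    rw [eq_top_iff]
    rintro x -
    obtain ⟨z, rfl⟩ := hq x
    obtain ⟨c, y, hc⟩ := hw z.1 z.2
    have : q (z - ∑ i, algebraMap k A (c i) • ⟨w i, hw0 i⟩) = 0 := by
      rw [hq0]
      refine ⟨y, ?_⟩
      simp [hc]
    rw [map_sub, sub_eq_zero, map_sum] at this
    rw [this]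
    refine Submodule.sum_mem _ fun i _ => ?_
    rw [map_smul]
    exact Submodule.smul_mem (M := ((ModuleCat.restrictScalars (algebraMap k A)).obj H)) _ (c i)
      (Submodule.subset_span (by
        exact Finset.mem_coe.2 (Finset.mem_image_of_mem _ (Finset.mem_univ i))))

end

theorem fd_sc (k : Type) [Field k] {A : Type} [Ring A] [Algebra k A]
    (S : ShortComplex (ModuleCat.{0} A)) (H : ModuleCat.{0} A) (e0 : H ≅ S.homology) :
    FiniteDimensional k ((ModuleCat.restrictScalars (algebraMap k A)).obj H) ↔
      FinH k S.f.hom S.g.hom := by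
  let e : H ≅ S.moduleCatLeftHomologyData.H := e0 ≪≫ S.moduleCatHomologyIso
  let q0 : LinearMap.ker S.g.hom →ₗ[A] S.moduleCatLeftHomologyData.H :=
    (LinearMap.range S.moduleCatToCycles).mkQ
  have hinj : Function.Injective e.inv.hom := by
    have := (ModuleCat.mono_iff_injective e.inv).1 inferInstance
    exact this
  have hsurj : Function.Surjective e.inv.hom := by
    have := (ModuleCat.epi_iff_surjective e.inv).1 inferInstance
    exact this
  refine fd_iff _ (e.inv.hom ∘ₗ q0) ?_ ?_
  · exact hsurj.comp (Submodule.mkQ_surjective _)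
  · intro z
    rw [LinearMap.comp_apply, ← map_zero e.inv.hom, hinj.eq_iff]
    refine (Submodule.Quotient.mk_eq_zero (LinearMap.range S.moduleCatToCycles)).trans ?_
    constructor
    · rintro ⟨y, hy⟩
      exact ⟨y, congrArg Subtype.val hy⟩
    · rintro ⟨y, hy⟩
      exact ⟨y, Subtype.ext hy⟩

theorem fd_homology (k : Type) [Field k] {A : Type} [Ring A] [Algebra k A]
    (X : CochainComplex (ModuleCat.{0} A) ℤ) (i j l : ℤ) (hij : i + 1 = j) (hjl : j + 1 = l) :
    FiniteDimensional k ((ModuleCat.restrictScalars (algebraMap k A)).obj (X.homology j)) ↔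
      FinH k (X.d i j).hom (X.d j l).hom := by
  have hi : (ComplexShape.up ℤ).prev j = i := by simp; omega
  have hl : (ComplexShape.up ℤ).next j = l := by simp; omega
  exact fd_sc k (X.sc' i j l) _ (X.homologyIsoSc' i j l hi hl)

theorem isZero_homology {A : Type} [Ring A]
    (X : CochainComplex (ModuleCat.{0} A) ℤ) (i j l : ℤ) (hij : i + 1 = j) (hjl : j + 1 = l) :
    Limits.IsZero (X.homology j) ↔
      ∀ z, (X.d j l).hom z = 0 → ∃ y, (X.d i j).hom y = z := by
  have hi : (ComplexShape.up ℤ).prev j = i := by simp; omega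
  have hl : (ComplexShape.up ℤ).next j = l := by simp; omega
  rw [← HomologicalComplex.exactAt_iff_isZero_homology, X.exactAt_iff' i j l hi hl,
    ShortComplex.moduleCat_exact_iff]
  rfl

end EpsAux

namespace EpsAux
open Finsupp

/-- A grading on an additive group encoded by a coaction `δ`. -/
structure IsGr {M ι : Type} [AddCommGroup M] (δ : M →+ (ι →₀ M)) : Prop where
  sum : ∀ m, ((δ m).sum fun _ x => x) = m
  idem : ∀ m i, δ (δ m i) = single i (δ m i)

/-- The homogeneous component of a coaction. -/
def grOf {M ι : Type} [AddCommGroup M] (δ : M →+ (ι →₀ M)) (i : ι) : AddSubgroup M where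
  carrier := {m | δ m = single i m}
  zero_mem' := by simp
  add_mem' := by
    intro a b (ha : δ a = _) (hb : δ b = _)
    change δ (a + b) = _
    rw [map_add, ha, hb, single_add]
  neg_mem' := by
    intro a (ha : δ a = _)
    change δ (-a) = _
    rw [map_neg, ha, single_neg]

theorem mem_grOf {M ι : Type} [AddCommGroup M] {δ : M →+ (ι →₀ M)} {i : ι} {m : M} :
    m ∈ grOf δ i ↔ δ m = single i m := Iff.rfl

section
variable {M N ι κ : Type} [AddCommGroup M] [AddCommGroup N]

/-- Summation of a finitely supported function, as an additive map. -/
noncomputable def sumHom (M ι : Type) [AddCommGroup M] : (ι →₀ M) →+ M :=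
  Finsupp.liftAddHom fun _ => AddMonoidHom.id M

theorem sumHom_apply (f : ι →₀ M) : sumHom M ι f = f.sum fun _ x => x := rfl

@[simp] theorem sumHom_single (i : ι) (m : M) : sumHom M ι (single i m) = m := by
  simp [sumHom]

theorem IsGr.sum' {δ : M →+ (ι →₀ M)} (h : IsGr δ) (m : M) : sumHom M ι (δ m) = m := h.sum m

theorem IsGr.closure {δ : M →+ (ι →₀ M)} (h : IsGr δ) :
    AddSubgroup.closure {m | ∃ i, δ m = single i m} = ⊤ := by
  rw [eq_top_iff]
  rintro m -
  rw [← h.sum m]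
  exact AddSubgroup.sum_mem _ fun i _ => AddSubgroup.subset_closure ⟨i, h.idem m i⟩

theorem IsGr.of_gens {δ : M →+ (ι →₀ M)} (S : Set M) (hS : AddSubgroup.closure S = ⊤)
    (h : ∀ s ∈ S, ∃ i, δ s = single i s) : IsGr δ := by
  classical
  constructor
  · intro m
    have : ((sumHom M ι).comp δ) = AddMonoidHom.id M := by
      refine AddMonoidHom.eq_of_eqOn_dense hS fun s hs => ?_
      obtain ⟨i, hi⟩ := h s hs
      simp [hi]
    exact DFunLike.congr_fun this m
  · intro m i
    have : (δ.comp ((Finsupp.applyAddHom i).comp δ)) =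
        (Finsupp.singleAddHom i).comp ((Finsupp.applyAddHom i).comp δ) := by
      refine AddMonoidHom.eq_of_eqOn_dense hS fun s hs => ?_
      obtain ⟨j, hj⟩ := h s hs
      by_cases hij : j = i
      · subst hij
        simp [hj]
      · simp [hj, hij]
    exact DFunLike.congr_fun this m

theorem IsGr.map_eq {δ : M →+ (ι →₀ M)} {δ' : N →+ (κ →₀ N)} (u : M →+ N) (φ : ι → κ)
    (S : Set M) (hS : AddSubgroup.closure S = ⊤)
    (h : ∀ s ∈ S, ∃ i, δ s = single i s ∧ δ' (u s) = single (φ i) (u s)) (m : M) :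
    δ' (u m) = mapDomain φ (mapRange u (map_zero u) (δ m)) := by
  have : δ'.comp u = (Finsupp.mapDomain.addMonoidHom φ).comp
      ((Finsupp.mapRange.addMonoidHom u).comp δ) := by
    refine AddMonoidHom.eq_of_eqOn_dense hS fun s hs => ?_
    obtain ⟨i, hi, hi'⟩ := h s hs
    simp [hi, hi', Finsupp.mapDomain_single]
  exact DFunLike.congr_fun this m

theorem IsGr.deg_of_gens {δ : M →+ (ι →₀ M)} {δ' : N →+ (κ →₀ N)} (u : M →+ N) (φ : ι → κ)
    (S : Set M) (hS : AddSubgroup.closure S = ⊤)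
    (h : ∀ s ∈ S, ∃ i, δ s = single i s ∧ δ' (u s) = single (φ i) (u s)) (i : ι) (m : M)
    (hm : δ m = single i m) : δ' (u m) = single (φ i) (u m) := by
  rw [IsGr.map_eq u φ S hS h, hm]
  simp [Finsupp.mapDomain_single]

theorem IsGr.map_eq' {δ : M →+ (ι →₀ M)} (hδ : IsGr δ) {δ' : N →+ (κ →₀ N)} (u : M →+ N)
    (φ : ι → κ) (h : ∀ i s, δ s = single i s → δ' (u s) = single (φ i) (u s)) (m : M) :
    δ' (u m) = mapDomain φ (mapRange u (map_zero u) (δ m)) :=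
  IsGr.map_eq u φ _ hδ.closure (by rintro s ⟨i, hi⟩; exact ⟨i, hi, h i s hi⟩) m

/-- Coordinates, for injective shifts. -/
theorem IsGr.coord {δ : M →+ (ι →₀ M)} (hδ : IsGr δ) {δ' : N →+ (κ →₀ N)} (u : M →+ N)
    (φ : ι → κ) (hφ : Function.Injective φ)
    (h : ∀ i s, δ s = single i s → δ' (u s) = single (φ i) (u s)) (m : M) (i : ι) :
    δ' (u m) (φ i) = u (δ m i) := by
  rw [hδ.map_eq' u φ h, Finsupp.mapDomain_apply hφ, Finsupp.mapRange_apply]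

theorem IsGr.internal [DecidableEq ι] {δ : M →+ (ι →₀ M)} (hδ : IsGr δ) :
    DirectSum.IsInternal (grOf δ) := by
  classical
  constructor
  · rw [injective_iff_map_eq_zero]
    intro x hx
    have key : ∀ y : DirectSum ι (fun i => grOf δ i), ∀ i,
        δ (DirectSum.coeAddMonoidHom (grOf δ) y) i = (y i : M) := by
      intro y i
      induction y using DirectSum.induction_on with
      | zero => simp
      | of j m =>
        rw [DirectSum.coeAddMonoidHom_of, mem_grOf.1 m.2, DirectSum.coe_of_apply,
          Finsupp.single_apply]
        split_ifs <;> simp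
      | add y z hy hz => simp [hy, hz]
    ext i
    rw [← key x i]
    have : DirectSum.coeAddMonoidHom (grOf δ) x = 0 := hx
    simp [this]
  · intro m
    refine ⟨∑ i ∈ (δ m).support, DirectSum.of (fun i => grOf δ i) i ⟨δ m i, hδ.idem m i⟩, ?_⟩
    refine (map_sum (DirectSum.coeAddMonoidHom (grOf δ)) _ _).trans ?_
    simp only [DirectSum.coeAddMonoidHom_of]
    exact hδ.sum m

theorem exists_isGr [DecidableEq ι] (g : ι → AddSubgroup M) (hg : DirectSum.IsInternal g) :
    ∃ δ : M →+ (ι →₀ M), IsGr δ ∧ ∀ i m, (m ∈ g i ↔ δ m = single i m) := by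
  classical
  let e : DirectSum ι (fun i => g i) ≃+ M := AddEquiv.ofBijective _ hg
  let δ0 : DirectSum ι (fun i => g i) →+ (ι →₀ M) :=
    DirectSum.toAddMonoid fun i => (Finsupp.singleAddHom i).comp (g i).subtype
  have h1 : ∀ i m, m ∈ g i → (δ0.comp e.symm.toAddMonoidHom) m = single i m := by
    intro i m hm
    have : e.symm m = DirectSum.of (fun i => g i) i ⟨m, hm⟩ := by
      rw [AddEquiv.symm_apply_eq]
      exact (DirectSum.coeAddMonoidHom_of g i ⟨m, hm⟩).symm
    simp [this, δ0]
  refine ⟨δ0.comp e.symm.toAddMonoidHom, IsGr.of_gens {m | ∃ i, m ∈ g i} ?_ ?_, fun i m => ⟨h1 i m, ?_⟩⟩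
  · rw [eq_top_iff]
    rintro m -
    obtain ⟨x, rfl⟩ := e.surjective m
    induction x using DirectSum.induction_on with
    | zero => simp
    | of j m =>
      refine AddSubgroup.subset_closure ⟨j, ?_⟩
      have : e (DirectSum.of (fun i => g i) j m) = m := DirectSum.coeAddMonoidHom_of g j m
      rw [this]
      exact m.2
    | add y z hy hz =>
      rw [map_add]
      exact add_mem hy hz
  · rintro s ⟨i, hi⟩
    exact ⟨i, h1 i s hi⟩
  · intro hm
    have key : ∀ x i, (δ0 x) i ∈ g i := by
      intro x i
      induction x using DirectSum.induction_on with
      | zero => simp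
      | of j m =>
        by_cases hij : j = i
        · subst hij
          simp [δ0]
        · simp [δ0, hij]
      | add y z hy hz =>
        rw [map_add]
        exact add_mem hy hz
    have := key (e.symm m) i
    have h2 : δ0 (e.symm m) = single i m := hm
    rw [h2] at this
    simpa using this

end
end EpsAux

namespace EpsAux
open Finsupp

/-- Unbundled version of an ε-object with nonzero cohomology. -/
structure Fam (k : Type) [Field k] (A : Type) [Ring A] [Algebra k A]
    {ι : Type} [AddCommGroup ι] (𝒜 : ι → Submodule k A) (M : ℤ → Type)
    [∀ n, AddCommGroup (M n)] [∀ n, Module k (M n)] [∀ n, Module A (M n)] where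
  d : ∀ i j, M i →ₗ[A] M j
  shape : ∀ i j, i + 1 ≠ j → d i j = 0
  dd : ∀ i j l x, d j l (d i j x) = 0
  bdd : ∃ N : ℕ, ∀ n : ℤ, (N : ℤ) < |n| → Subsingleton (M n)
  proj : ∀ n, Module.Projective A (M n)
  fin : ∀ n, Module.Finite A (M n)
  δ : ∀ n, M n →ₗ[k] (ι →₀ M n)
  gr : ∀ n, IsGr (δ n).toAddMonoidHom
  smul : ∀ n i j a m, a ∈ 𝒜 i → δ n m = single j m → δ n (a • m) = single (i + j) (a • m)
  dδ : ∀ n n' i m, δ n m = single i m → δ n' (d n n' m) = single i (d n n' m)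
  finH : ∀ i j l, i + 1 = j → j + 1 = l → FinH k (d i j) (d j l)
  nz : ∃ i j l, i + 1 = j ∧ j + 1 = l ∧ ∃ z, d j l z = 0 ∧ ∀ y, d i j y ≠ z

theorem Fam.intro {k : Type} [Field k] {A : Type} [Ring A] [Algebra k A]
    {ι : Type} [AddCommGroup ι] [DecidableEq ι] {𝒜 : ι → Submodule k A} {M : ℤ → Type}
    [∀ n, AddCommGroup (M n)] [∀ n, Module k (M n)] [∀ n, Module A (M n)]
    (F : Fam k A 𝒜 M) : EpsCondition k A 𝒜 := by
  let X : CochainComplex (ModuleCat.{0} A) ℤ :=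
    { X := fun n => ModuleCat.of A (M n)
      d := fun i j => ModuleCat.ofHom (F.d i j)
      shape := by
        intro i j hij
        rw [F.shape i j hij]
        rfl
      d_comp_d' := by
        intro i j l _ _
        ext x
        exact F.dd i j l x }
  refine ⟨{ X := X, bounded := ?_, proj := ?_, fg := F.fin,
            gr := fun n => grOf (F.δ n).toAddMonoidHom, internal := fun n => (F.gr n).internal,
            smul_mem := ?_, d_mem := ?_, findim := ?_ }, ?_⟩
  · obtain ⟨N, hN⟩ := F.bdd
    refine ⟨N, fun n hn => ?_⟩
    have := hN n hn
    exact ModuleCat.isZero_of_subsingleton (ModuleCat.of A (M n))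
  · intro n
    have := F.proj n
    exact (IsProjective.iff_projective (M n)).1 this
  · intro n i j a m ha hm
    exact F.smul n i j a m ha hm
  · intro n i m hm
    exact F.dδ n (n + 1) i m hm
  · intro n
    have h1 : n - 1 + 1 = n := by omega
    rw [fd_homology k X (n - 1) n (n + 1) h1 rfl]
    exact F.finH (n - 1) n (n + 1) h1 rfl
  · obtain ⟨i, j, l, hij, hjl, z, hz, hy⟩ := F.nz
    refine ⟨j, ?_⟩
    change ¬ Limits.IsZero (X.homology j)
    rw [isZero_homology X i j l hij hjl]
    intro h
    obtain ⟨y, hy'⟩ := h z hz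
    exact hy y hy'

theorem elim {k : Type} [Field k] {A : Type} [Ring A] [Algebra k A]
    {ι : Type} [AddCommGroup ι] [DecidableEq ι] {𝒜 : ι → Submodule k A}
    (h0 : ∀ c : k, algebraMap k A c ∈ 𝒜 0) (h : EpsCondition k A 𝒜) {P : Prop}
    (hP : ∀ (M : ℤ → Type) [∀ n, AddCommGroup (M n)] [∀ n, Module k (M n)]
      [∀ n, Module A (M n)] [∀ n, IsScalarTower k A (M n)], Fam k A 𝒜 M → P) : P := by
  obtain ⟨E, n₀, hn₀⟩ := h
  let _ : ∀ n, Module k (E.X.X n) := fun n => Module.compHom _ (algebraMap k A)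
  have : ∀ n, IsScalarTower k A (E.X.X n) := fun n => ⟨fun c a m => by
    change (c • a) • m = algebraMap k A c • a • m
    rw [Algebra.smul_def, mul_smul]⟩
  choose δ hδ hδ' using fun n => exists_isGr (E.gr n) (E.internal n)
  refine hP (fun n => E.X.X n)
    { d := fun i j => (E.X.d i j).hom
      shape := ?_, dd := ?_, bdd := ?_, proj := ?_, fin := E.fg
      δ := fun n => { δ n with map_smul' := ?_ }
      gr := hδ, smul := ?_, dδ := ?_, finH := ?_, nz := ?_ }
  · intro i j hij
    rw [E.X.shape i j hij]
    rfl
  · intro i j l x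
    exact congrArg (fun f => f.hom x) (E.X.d_comp_d i j l)
  · obtain ⟨N, hN⟩ := E.bounded
    exact ⟨N, fun n hn => ModuleCat.isZero_iff_subsingleton.1 (hN n hn)⟩
  · intro n
    exact (IsProjective.iff_projective (E.X.X n)).2 (E.proj n)
  · intro c m
    ext i
    have := (hδ n).coord (δ' := δ n) (DistribSMul.toAddMonoidHom (E.X.X n)
      (algebraMap k A c)) (fun i => i) Function.injective_id (fun i s hs => by
        have := (hδ' n _ _).1 (E.smul_mem n 0 i (algebraMap k A c) s (h0 c) ((hδ' n _ _).2 hs))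
        rw [zero_add] at this
        exact this) m i
    exact this
  · intro n i j a m ha hm
    exact (hδ' n _ _).1 (E.smul_mem n i j a m ha ((hδ' n _ _).2 hm))
  · intro n n' i m hm
    by_cases hn : n + 1 = n'
    · subst hn
      exact (hδ' _ _ _).1 (E.d_mem n i m ((hδ' _ _ _).2 hm))
    · rw [E.X.shape n n' hn]
      simp
  · intro i j l hij hjl
    exact (fd_homology k E.X i j l hij hjl).1 (E.findim j)
  · have h1 : n₀ - 1 + 1 = n₀ := by omega
    rw [isZero_homology E.X (n₀ - 1) n₀ (n₀ + 1) h1 rfl] at hn₀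
    push Not at hn₀
    exact ⟨n₀ - 1, n₀, n₀ + 1, h1, rfl, hn₀⟩

/-- Collapsing a grading along a homomorphism. -/
noncomputable def collapse {k : Type} [Field k] {M ι κ : Type} [AddCommGroup M] [Module k M]
    (f : ι → κ) (δ : M →ₗ[k] (ι →₀ M)) : M →ₗ[k] (κ →₀ M) :=
  (Finsupp.lmapDomain M k f).comp δ

theorem collapse_gr {k : Type} [Field k] {M ι κ : Type} [AddCommGroup M] [Module k M]
    (f : ι → κ) (δ : M →ₗ[k] (ι →₀ M)) (h : IsGr δ.toAddMonoidHom) :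
    IsGr (collapse f δ).toAddMonoidHom := by
  refine IsGr.of_gens _ h.closure ?_
  rintro s ⟨i, hi⟩
  refine ⟨f i, ?_⟩
  change δ s = _ at hi
  simp [collapse, hi, Finsupp.mapDomain_single]

theorem collapse_deg {k : Type} [Field k] {M N ι κ : Type} [AddCommGroup M] [Module k M]
    [AddCommGroup N] [Module k N] (f : ι → κ) (δ : M →ₗ[k] (ι →₀ M)) (δ' : N →ₗ[k] (ι →₀ N))
    (h : IsGr δ.toAddMonoidHom) (u : M →+ N) (φ : ι → ι) (φ' : κ → κ)
    (hφ : ∀ i, f (φ i) = φ' (f i))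
    (hu : ∀ i m, δ m = single i m → δ' (u m) = single (φ i) (u m)) (i : κ) (m : M)
    (hm : collapse f δ m = single i m) : collapse f δ' (u m) = single (φ' i) (u m) := by
  refine IsGr.deg_of_gens (δ := (collapse f δ).toAddMonoidHom)
    (δ' := (collapse f δ').toAddMonoidHom) u φ' _ h.closure ?_ i m hm
  rintro s ⟨i, hi⟩
  change δ s = _ at hi
  refine ⟨f i, ?_, ?_⟩
  · simp [collapse, hi, Finsupp.mapDomain_single]
  · simp [collapse, hu i s hi, Finsupp.mapDomain_single, hφ]

theorem smul_span {k : Type} [Field k] {A : Type} [Ring A] [Algebra k A] {M κ : Type}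
    [AddCommGroup M] [Module k M] [Module A M] [IsScalarTower k A M] (δ : M →ₗ[k] (κ →₀ M))
    (S : Set A) (m : M) (i : κ) (h : ∀ a ∈ S, δ (a • m) = single i (a • m)) (a : A)
    (ha : a ∈ Submodule.span k S) : δ (a • m) = single i (a • m) := by
  induction ha using Submodule.span_induction with
  | mem x hx => exact h x hx
  | zero => simp
  | add x y _ _ hx hy => simp [add_smul, hx, hy]
  | smul c x _ hx => simp [hx]

theorem one_to_two {k : Type} [Field k] {R : Type} [Ring R] [Algebra k R]
    {ι κ : Type} [AddCommGroup ι] [DecidableEq ι] [AddCommGroup κ] [DecidableEq κ]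
    {𝒜 : ι → Submodule k R} {ℬ : κ → Submodule k R} (f : ι →+ κ)
    (h0 : ∀ c : k, algebraMap k R c ∈ 𝒜 0)
    (hℬ : ∀ n, ℬ n ≤ Submodule.span k {x | ∃ i, f i = n ∧ x ∈ 𝒜 i})
    (h : EpsCondition k R 𝒜) : EpsCondition k R ℬ := by
  refine elim h0 h fun M _ _ _ _ F => ?_
  refine Fam.intro (M := M)
    { d := F.d, shape := F.shape, dd := F.dd, bdd := F.bdd, proj := F.proj, fin := F.fin
      finH := F.finH, nz := F.nz
      δ := fun n => collapse f (F.δ n)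
      gr := fun n => collapse_gr f _ (F.gr n)
      smul := ?_
      dδ := ?_ }
  · intro n i j a m ha hm
    refine smul_span _ _ m (i + j) ?_ a (hℬ i ha)
    rintro a' ⟨i, rfl, ha'⟩
    exact collapse_deg f (F.δ n) (F.δ n) (F.gr n) (DistribSMul.toAddMonoidHom _ a')
      (i + ·) (f i + ·) (fun _ => map_add _ _ _) (fun j m hm => F.smul n i j a' m ha' hm) j m hm
  · intro n n' i m hm
    exact collapse_deg f (F.δ n) (F.δ n') (F.gr n) (F.d n n').toAddMonoidHom id id
      (fun _ => rfl) (fun j m hm => F.dδ n n' j m hm) i m hm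

end EpsAux

namespace EpsAux

section
variable {B : Type} [Ring B]

/-- The submodule generated by `J • M`. -/
def JM (J : Set B) (M : Type) [AddCommGroup M] [Module B M] : Submodule B M :=
  Submodule.span B {x | ∃ b ∈ J, ∃ m : M, x = b • m}

theorem JM_map (J : Set B) {M N : Type} [AddCommGroup M] [Module B M] [AddCommGroup N]
    [Module B N] (f : M →ₗ[B] N) (x : M) (hx : x ∈ JM J M) : f x ∈ JM J N := by
  induction hx using Submodule.span_induction with
  | mem x hx =>
    obtain ⟨b, hb, m, rfl⟩ := hx
    exact Submodule.subset_span ⟨b, hb, f m, by simp⟩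
  | zero => simp
  | add x y _ _ hx hy => rw [map_add]; exact add_mem hx hy
  | smul c x _ hx => rw [map_smul]; exact Submodule.smul_mem _ _ hx

theorem exists_split (M : ℤ → Type) [∀ n, AddCommGroup (M n)] [∀ n, Module B (M n)]
    (d : ∀ n, M n →ₗ[B] M (n + 1)) (dd : ∀ n x, d (n + 1) (d n x) = 0)
    (proj : ∀ n, Module.Projective B (M n))
    (N t : ℤ) (bdd : ∀ n, N < n → Subsingleton (M n))
    (ex : ∀ n, t < n + 1 → ∀ z, d (n + 1) z = 0 → ∃ y, d n y = z)
    (n : ℤ) (hn : t ≤ n) : ∃ s : M (n + 1) →ₗ[B] M n, ∀ x, d n (s (d n x)) = d n x := by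
  obtain ⟨m, hm⟩ : ∃ m : ℕ, N < n + m := ⟨(N - n + 1).toNat, by omega⟩
  induction m generalizing n with
  | zero =>
    have := bdd n (by simpa using hm)
    exact ⟨0, fun x => by rw [Subsingleton.elim x 0]; simp⟩
  | succ m ih =>
    obtain ⟨s, hs⟩ := ih (n + 1) (by omega) (by push_cast at hm; omega)
    let r : M (n + 1) →ₗ[B] M (n + 1) := LinearMap.id - s ∘ₗ d (n + 1)
    have hr : ∀ x, r x ∈ LinearMap.range (d n) := by
      intro x
      refine ex n (by omega) _ ?_
      simp [r, hs]
    have := proj (n + 1)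
    obtain ⟨s', hs'⟩ := Module.projective_lifting_property (d n).rangeRestrict
      (r.codRestrict _ hr) (d n).surjective_rangeRestrict
    refine ⟨s', fun x => ?_⟩
    have h1 : d n (s' (d n x)) = r (d n x) :=
      congrArg Subtype.val (LinearMap.congr_fun hs' (d n x))
    rw [h1]
    simp [r, dd]

/-- The key finiteness statement: if the cohomology of a bounded above complex of projectives
over a noetherian ring is finitely generated, then so is the cohomology of its reduction. -/
theorem key [IsNoetherianRing B] (J : Set B) (s : ℕ) :
    ∀ (M : ℤ → Type) [∀ n, AddCommGroup (M n)] [∀ n, Module B (M n)]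
    (d : ∀ n, M n →ₗ[B] M (n + 1)) (_ : ∀ n x, d (n + 1) (d n x) = 0)
    (_ : ∀ n, Module.Projective B (M n))
    (N t : ℤ) (_ : ∀ n, N < n → Subsingleton (M n))
    (_ : ∀ n, t < n + 1 → ∀ z, d (n + 1) z = 0 → ∃ y, d n y = z)
    (_ : ∀ n, ∃ (r : ℕ) (f : (Fin r → B) →ₗ[B] M (n + 1)), (∀ p, d (n + 1) (f p) = 0) ∧
      ∀ z, d (n + 1) z = 0 → ∃ p y, z = f p + d n y)
    (n : ℤ) (_ : t < n + 1 + s), ∃ V : Submodule B (M (n + 1)), V.FG ∧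
      ∀ c, d (n + 1) c ∈ JM J (M (n + 1 + 1)) →
        ∃ x ∈ JM J (M (n + 1)), ∃ y, ∃ v ∈ V, c = x + d n y + v := by
  induction s with
  | zero =>
    intro M _ _ d dd proj N t bdd ex fg n hn
    obtain ⟨s, hs⟩ := exists_split M d dd proj N t bdd ex (n + 1) (by push_cast at hn; omega)
    refine ⟨⊥, Submodule.fg_bot, fun c hc => ?_⟩
    obtain ⟨y, hy⟩ := ex n (by push_cast at hn; omega) (c - s (d (n + 1) c)) (by simp [hs])
    exact ⟨s (d (n + 1) c), JM_map J s _ hc, y, 0, by simp, by rw [hy]; abel⟩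
  | succ s ih =>
    intro M _ _ d dd proj N t bdd ex fg n hn
    have fg' : ∀ n, ∃ (r : ℕ) (f : (Fin r → B) →ₗ[B] M (n + 1)), (t < n + 1 → r = 0) ∧
      (∀ p, d (n + 1) (f p) = 0) ∧ ∀ z, d (n + 1) z = 0 → ∃ p y, z = f p + d n y := by
      intro n
      by_cases h : t < n + 1
      · refine ⟨0, 0, fun _ => rfl, by simp, fun z hz => ?_⟩
        obtain ⟨y, hy⟩ := ex n h z hz
        exact ⟨0, y, by simp [hy]⟩
      · obtain ⟨r, f, h1, h2⟩ := fg n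
        exact ⟨r, f, fun h' => absurd h' h, h1, h2⟩
    choose r f hr hf0 hf using fg'
    let C : ℤ → Type := fun n => M n × (Fin (r n) → B)
    let D : ∀ n, C n →ₗ[B] C (n + 1) := fun n =>
      ((d n).coprod (f n)).prod 0
    have hD : ∀ n m p, D n (m, p) = (d n m + f n p, 0) := fun n m p => rfl
    have step : ∃ V : Submodule B (C (n + 1)), V.FG ∧
      ∀ c, D (n + 1) c ∈ JM J (C (n + 1 + 1)) →
        ∃ x ∈ JM J (C (n + 1)), ∃ y, ∃ v ∈ V, c = x + D n y + v := by
      refine ih C D ?_ ?_ (max N t) (t - 1) ?_ ?_ ?_ n (by push_cast at hn; omega)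
      · rintro n ⟨m, p⟩
        rw [hD, hD]
        refine Prod.ext ?_ rfl
        simp [dd, hf0]
      · intro n
        have := proj n
        exact inferInstanceAs (Module.Projective B (M n × (Fin (r n) → B)))
      · intro n hn
        have h1 := bdd n (by omega)
        have h2 : r n = 0 := hr n (by omega)
        have : IsEmpty (Fin (r n)) := by rw [h2]; infer_instance
        exact inferInstanceAs (Subsingleton (M n × (Fin (r n) → B)))
      · rintro n hn ⟨m, p⟩ hz
        have h2 : r (n + 1) = 0 := hr (n + 1) (by omega)
        have : IsEmpty (Fin (r (n + 1))) := by rw [h2]; infer_instance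
        have hp : p = 0 := Subsingleton.elim _ _
        subst hp
        rw [hD, map_zero, add_zero] at hz
        obtain ⟨p, y, h⟩ := hf n m (congrArg Prod.fst hz)
        refine ⟨(y, p), ?_⟩
        rw [hD, h, add_comm (d n y)]
      · intro n
        let K : Submodule B (Fin (r (n + 1)) → B) :=
          (LinearMap.range (d (n + 1))).comap (f (n + 1))
        obtain ⟨q, g, hg⟩ := Submodule.fg_iff_exists_fin_generating_family.1
          (IsNoetherian.noetherian K)
        have hgK : ∀ j, g j ∈ K := fun j => by rw [← hg]; exact Submodule.subset_span ⟨j, rfl⟩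
        choose m hm using hgK
        refine ⟨q, Fintype.linearCombination B (fun j => ((-m j, g j) : C (n + 1))), ?_, ?_⟩
        · intro p
          rw [Fintype.linearCombination_apply, map_sum]
          refine Finset.sum_eq_zero fun j _ => ?_
          rw [map_smul, hD, map_neg, hm, neg_add_cancel]
          exact smul_zero (A := M (n + 1 + 1) × (Fin (r (n + 1 + 1)) → B)) _
        · rintro ⟨m', p⟩ hz
          have hz' : d (n + 1) m' + f (n + 1) p = 0 := congrArg Prod.fst hz
          have hp : p ∈ K := ⟨-m', by rw [map_neg]; exact (eq_neg_of_add_eq_zero_right hz').symm⟩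
          rw [← hg, Submodule.mem_span_range_iff_exists_fun] at hp
          obtain ⟨c, hc⟩ := hp
          have h0 : d (n + 1) (m' + ∑ j, c j • m j) = 0 := by
            rw [map_add, map_sum]
            simp only [map_smul, hm]
            rw [← hz', ← hc]
            simp
          obtain ⟨p', y, h⟩ := hf n _ h0
          refine ⟨c, (y, p'), ?_⟩
          rw [hD, Fintype.linearCombination_apply]
          change (m', p) = ∑ i, (c i • ((-m i, g i) : M (n + 1) × (Fin (r (n + 1)) → B))) + _
          refine Prod.ext ?_ ?_
          · rw [Prod.fst_add, Prod.fst_sum]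
            simp only [Prod.smul_mk, smul_neg, Finset.sum_neg_distrib]
            rw [add_comm (d n y), ← h]
            abel
          · rw [Prod.snd_add, Prod.snd_sum]
            simp [hc]
    obtain ⟨V, hV, hV'⟩ := step
    refine ⟨V.map (LinearMap.fst B _ _) ⊔ LinearMap.range (f n),
      (hV.map _).sup (Module.Finite.iff_fg.1 inferInstance), fun c hc => ?_⟩
    obtain ⟨x, hx, y, v, hv, h⟩ := hV' (c, 0) (by
      rw [hD, map_zero, add_zero]
      exact JM_map J (N := M (n + 1 + 1) × (Fin (r (n + 1 + 1)) → B))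
        (LinearMap.inl B (M (n + 1 + 1)) (Fin (r (n + 1 + 1)) → B)) _ hc)
    refine ⟨x.1, JM_map J (LinearMap.fst B (M (n + 1)) (Fin (r (n + 1)) → B)) _ hx, y.1, v.1 + f n y.2,
      add_mem (Submodule.mem_sup_left ⟨v, hv, rfl⟩) (Submodule.mem_sup_right ⟨_, rfl⟩), ?_⟩
    have h3 : c = x.1 + (d n y.1 + f n y.2) + v.1 := congrArg Prod.fst h
    rw [h3]
    abel

end
end EpsAux

namespace EpsAux
open Finsupp

/-- Homogeneous elements of positive degree. -/
def posSet {k B : Type} [Field k] [Ring B] [Algebra k B] (ℬ : ℤ → Submodule k B) : Set B :=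
  {b | ∃ i, 0 < i ∧ b ∈ ℬ i}

theorem pos_split {k B : Type} [Field k] [Ring B] [Algebra k B] (ℬ : ℤ → Submodule k B)
    [GradedAlgebra ℬ] (hconn : ℬ 0 = Submodule.span k {(1 : B)})
    (hpos : ∀ n : ℤ, n < 0 → ℬ n = ⊥) (b : B) :
    ∃ c : k, b - algebraMap k B c ∈ AddSubgroup.closure (posSet ℬ) := by
  induction b using DirectSum.Decomposition.inductionOn ℬ with
  | zero => exact ⟨0, by simp⟩
  | @homogeneous i m =>
    rcases lt_trichotomy i 0 with h | h | h
    · have : (m : B) = 0 := by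
        have := (hpos i h).le m.2
        simpa using this
      exact ⟨0, by simp [this]⟩
    · subst h
      have := hconn.le m.2
      rw [Submodule.mem_span_singleton] at this
      obtain ⟨c, hc⟩ := this
      refine ⟨c, ?_⟩
      rw [← hc, Algebra.algebraMap_eq_smul_one, sub_self]
      exact zero_mem _
    · refine ⟨0, ?_⟩
      rw [map_zero, sub_zero]
      exact AddSubgroup.subset_closure (show m.1 ∈ posSet ℬ from ⟨i, h, m.2⟩)
  | add x y hx hy =>
    obtain ⟨c, hc⟩ := hx
    obtain ⟨c', hc'⟩ := hy
    refine ⟨c + c', ?_⟩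
    have := add_mem hc hc'
    rw [map_add]
    convert this using 1
    abel

theorem nak {k B : Type} [Field k] [Ring B] [Algebra k B] (ℬ : ℤ → Submodule k B)
    [GradedAlgebra ℬ] (hpos : ∀ n : ℤ, n < 0 → ℬ n = ⊥)
    {M' M M'' : Type} [AddCommGroup M'] [AddCommGroup M] [AddCommGroup M''] [Module B M']
    [Module B M] [Module B M''] (d : M' →ₗ[B] M) (g : M →ₗ[B] M'')
    (δ' : M' →+ (ℤ →₀ M')) (δ : M →+ (ℤ →₀ M))
    (hδ : ∀ p, ∀ b ∈ ℬ p, ∀ m i, δ (b • m) (p + i) = b • δ m i)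
    (hd : ∀ y e, δ (d y) e = d (δ' y e))
    (e₀ : ℤ) (he : ∀ z, g z = 0 → ∀ e < e₀, ∃ y, d y = δ z e)
    (hJ : ∀ z, g z = 0 → ∃ y, ∃ x ∈ JM (posSet ℬ) (LinearMap.ker g), z = d y + x.1) :
    ∀ z, g z = 0 → ∀ e, ∃ y, d y = δ z e := by
  have hδ' : ∀ p, ∀ b ∈ ℬ p, ∀ m i, δ (b • m) i = b • δ m (i - p) := by
    intro p b hb m i
    rw [← hδ p b hb, add_sub_cancel]
  have step : ∀ e, (∀ z, g z = 0 → ∀ e' < e, ∃ y, d y = δ z e') →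
      ∀ x ∈ JM (posSet ℬ) (LinearMap.ker g), ∀ e' ≤ e, δ x.1 e' ∈ LinearMap.range d := by
    intro e ih x hx
    induction hx using Submodule.span_induction with
    | mem x hx =>
      obtain ⟨b, ⟨p, hp, hb⟩, z, rfl⟩ := hx
      intro e' he'
      change δ (b • z.1) e' ∈ _
      rw [hδ' p b hb]
      exact Submodule.smul_mem _ _ (ih z.1 z.2 _ (by omega))
    | zero => simp
    | add x y _ _ hx hy =>
      intro e' he'
      rw [Submodule.coe_add, map_add, Finsupp.add_apply]
      exact add_mem (hx e' he') (hy e' he')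
    | smul b x _ hx =>
      induction b using DirectSum.Decomposition.inductionOn ℬ with
      | zero => simp
      | @homogeneous i m =>
        intro e' he'
        rcases lt_or_ge i 0 with h | h
        · have : (m : B) = 0 := by
            have := (hpos i h).le m.2
            simpa using this
          simp [this]
        · change δ (m.1 • x.1) e' ∈ _
          rw [hδ' i _ m.2]
          exact Submodule.smul_mem _ _ (hx _ (by omega))
      | add a b ha hb =>
        intro e' he'
        rw [add_smul, Submodule.coe_add, map_add, Finsupp.add_apply]
        exact add_mem (ha e' he') (hb e' he')
  have main : ∀ n : ℕ, ∀ z, g z = 0 → ∀ e < e₀ + n, ∃ y, d y = δ z e := by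
    intro n
    induction n with
    | zero => simpa using he
    | succ n ih =>
      intro z hz e hen
      obtain ⟨y, x, hx, hxy⟩ := hJ z hz
      obtain ⟨y', hy'⟩ := step (e₀ + n) ih x hx e (by push_cast at hen; omega)
      refine ⟨δ' y e + y', ?_⟩
      rw [map_add, hy', ← hd, hxy, map_add, Finsupp.add_apply]
  intro z hz e
  exact main (e - e₀ + 1).toNat z hz e (by omega)

theorem exists_factor {k M Q P : Type} [Ring k] [AddCommGroup M] [AddCommGroup Q] [AddCommGroup P]
    [Module k M] [Module k Q] [Module k P] (π : M →ₗ[k] Q) (hπ : Function.Surjective π)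
    (g : M →ₗ[k] P) (h : ∀ m, π m = 0 → g m = 0) : ∃ g' : Q →ₗ[k] P, ∀ m, g' (π m) = g m := by
  refine ⟨(Submodule.liftQ (LinearMap.ker π) g (fun m hm => h m hm)).comp
    (π.quotKerEquivOfSurjective hπ).symm.toLinearMap, fun m => ?_⟩
  have : (π.quotKerEquivOfSurjective hπ).symm (π m) = Submodule.Quotient.mk m := by
    rw [LinearEquiv.symm_apply_eq]
    rfl
  simp only [LinearMap.comp_apply, LinearEquiv.coe_coe, this]
  rfl

theorem quot_gr {k M Q ι : Type} [Field k] [AddCommGroup M] [AddCommGroup Q]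
    [Module k M] [Module k Q] (π : M →ₗ[k] Q) (hπ : Function.Surjective π)
    (δ : M →ₗ[k] (ι →₀ M)) (hδ : IsGr δ.toAddMonoidHom)
    (h : ∀ m, π m = 0 → ∀ i, π (δ m i) = 0) : ∃ δ' : Q →ₗ[k] (ι →₀ Q),
      IsGr δ'.toAddMonoidHom ∧ (∀ m i, δ' (π m) i = π (δ m i)) ∧
      (∀ q i, δ' q = single i q → ∃ m, π m = q ∧ δ m = single i m) := by
  obtain ⟨δ', h'⟩ := exists_factor π hπ ((Finsupp.mapRange.linearMap π).comp δ) (by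
    intro m hm
    ext i
    simpa using h m hm i)
  have h'' : ∀ m i, δ' (π m) i = π (δ m i) := fun m i => by rw [h']; rfl
  refine ⟨δ', ?_, h'', ?_⟩
  · refine IsGr.of_gens (Set.range fun p : M × ι => π (δ p.1 p.2)) ?_ ?_
    · rw [eq_top_iff]
      rintro q -
      obtain ⟨m, rfl⟩ := hπ q
      rw [← hδ.sum m, Finsupp.sum, map_sum]
      exact AddSubgroup.sum_mem _ fun i _ => AddSubgroup.subset_closure ⟨(m, i), rfl⟩
    · rintro _ ⟨⟨m, i⟩, rfl⟩
      refine ⟨i, ?_⟩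
      change δ' (π (δ m i)) = _
      rw [h']
      have := hδ.idem m i
      change δ (δ m i) = _ at this
      simp [this]
  · intro q i hq
    obtain ⟨m, rfl⟩ := hπ q
    refine ⟨δ m i, ?_, hδ.idem m i⟩
    rw [← h'', hq, single_eq_same]

theorem quot_proj {R A M Q : Type} [Ring R] [Ring A] [AddCommGroup M] [AddCommGroup Q]
    [Module R M] [Module A Q] (ρ : R →+* A) (hρs : Function.Surjective ρ)
    (π : M →+ Q) (hπ : Function.Surjective π)
    (hρ : ∀ r m, π (r • m) = ρ r • π m) (hf : ∀ (f : M →ₗ[R] R) m, π m = 0 → ρ (f m) = 0)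
    (hp : Module.Projective R M) (hfin : Module.Finite R M) :
    Module.Projective A Q ∧ Module.Finite A Q := by
  obtain ⟨n, f, hfs⟩ := Module.Finite.exists_fin' R M
  obtain ⟨s, hs⟩ := Module.projective_lifting_property f LinearMap.id hfs
  have hs' : ∀ m, f (s m) = m := fun m => LinearMap.congr_fun hs m
  let F : (Fin n → A) →ₗ[A] Q := Fintype.linearCombination A fun i => π (f (Pi.single i 1))
  have hF : ∀ p : Fin n → R, F (fun i => ρ (p i)) = π (f p) := by
    intro p
    rw [Fintype.linearCombination_apply]
    conv_rhs => rw [pi_eq_sum_univ' p]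
    rw [map_sum, map_sum]
    refine Finset.sum_congr rfl fun i _ => ?_
    rw [map_smul, hρ]
  have hmk : ∀ m m', π m = π m' → ∀ i, ρ (s m i) = ρ (s m' i) := by
    intro m m' h i
    have := hf ((LinearMap.proj i).comp s) (m - m') (by rw [map_sub, h, sub_self])
    simpa [sub_eq_zero] using this
  let σ0 : Q → (Fin n → A) := fun q i => ρ (s (Function.surjInv hπ q) i)
  have hσ0 : ∀ m, σ0 (π m) = fun i => ρ (s m i) := fun m => by
    ext i
    exact hmk _ _ (Function.surjInv_eq hπ _) i
  let σ : Q →ₗ[A] (Fin n → A) :=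
    { toFun := σ0
      map_add' := by
        intro x y
        obtain ⟨x, rfl⟩ := hπ x
        obtain ⟨y, rfl⟩ := hπ y
        rw [← map_add, hσ0, hσ0, hσ0]
        ext i
        simp
      map_smul' := by
        intro a x
        obtain ⟨x, rfl⟩ := hπ x
        obtain ⟨r, rfl⟩ := hρs a
        rw [← hρ, hσ0, hσ0]
        ext i
        simp }
  have hFσ : F.comp σ = LinearMap.id := by
    ext q
    obtain ⟨m, rfl⟩ := hπ q
    change F (σ0 (π m)) = π m
    rw [hσ0, hF, hs']
  refine ⟨Module.Projective.of_split σ F hFσ, ?_⟩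
  refine Module.Finite.of_surjective F fun q => ⟨σ q, LinearMap.congr_fun hFσ q⟩

end EpsAux

namespace EpsAux
open Finsupp

/-- Restriction of scalars of a linear map along a ring homomorphism. -/
def resL {R B M N : Type} [Ring R] [Ring B] [AddCommGroup M] [AddCommGroup N] [Module R M]
    [Module R N] [Module B M] [Module B N] (ψ : B →+* R) (hM : ∀ (b : B) (m : M), b • m = ψ b • m)
    (hN : ∀ (b : B) (m : N), b • m = ψ b • m) (f : M →ₗ[R] N) : M →ₗ[B] N :=
  { f with map_smul' := fun b m => by
            change f (b • m) = b • f m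
            rw [hM, hN, map_smul] }

theorem res_proj {R B M : Type} [Ring R] [Ring B] [AddCommGroup M] [Module R M] [Module B M]
    [Module B R] (ψ : B →+* R) (hM : ∀ (b : B) (m : M), b • m = ψ b • m)
    (hR : ∀ (b : B) (m : R), b • m = ψ b * m) (hp : Module.Projective B R)
    (h : Module.Projective R M) : Module.Projective B M := by
  classical
  obtain ⟨s, hs⟩ := h.out
  have hp' : Module.Projective B (M →₀ R) :=
    Module.Projective.of_equiv' (finsuppLEquivDirectSum B R M).symm
  refine Module.Projective.of_split (M := (M →₀ R)) (resL ψ hM ?_ s)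
    (resL ψ ?_ hM (Finsupp.linearCombination R id)) ?_
  · intro b m
    ext i
    simp [hR]
  · intro b m
    ext i
    simp [hR]
  · ext m
    exact hs m

theorem JM_stable {k B : Type} [Field k] [Ring B] [Algebra k B] (ℬ : ℤ → Submodule k B)
    [GradedAlgebra ℬ] {M : Type} [AddCommGroup M] [Module B M] (δ : M →+ (ℤ →₀ M))
    (hδ : ∀ p, ∀ b ∈ ℬ p, ∀ m i, δ (b • m) (p + i) = b • δ m i) (x : M)
    (hx : x ∈ JM (posSet ℬ) M) : ∀ i, δ x i ∈ JM (posSet ℬ) M := by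
  have hδ' : ∀ p, ∀ b ∈ ℬ p, ∀ m i, δ (b • m) i = b • δ m (i - p) := by
    intro p b hb m i
    rw [← hδ p b hb, add_sub_cancel]
  induction hx using Submodule.span_induction with
  | mem x hx =>
    obtain ⟨b, ⟨p, hp, hb⟩, z, rfl⟩ := hx
    intro i
    rw [hδ' p b hb]
    exact Submodule.subset_span ⟨b, ⟨p, hp, hb⟩, _, rfl⟩
  | zero => simp
  | add x y _ _ hx hy =>
    intro i
    rw [map_add, Finsupp.add_apply]
    exact add_mem (hx i) (hy i)
  | smul b x _ hx =>
    induction b using DirectSum.Decomposition.inductionOn ℬ with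
    | zero => simp
    | @homogeneous p m =>
      intro i
      rw [hδ' p _ m.2]
      exact Submodule.smul_mem _ _ (hx _)
    | add a b ha hb =>
      intro i
      rw [add_smul, map_add, Finsupp.add_apply]
      exact add_mem (ha i) (hb i)

theorem closure_smul_JM {B : Type} [Ring B] (J : Set B) {M : Type} [AddCommGroup M] [Module B M]
    (b : B) (hb : b ∈ AddSubgroup.closure J) (m : M) : b • m ∈ JM J M := by
  induction hb using AddSubgroup.closure_induction with
  | mem x hx => exact Submodule.subset_span ⟨x, hx, m, rfl⟩
  | zero => simp
  | add x y _ _ hx hy => rw [add_smul]; exact add_mem hx hy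
  | neg x _ hx => rw [neg_smul]; exact neg_mem hx

end EpsAux

namespace EpsAux
open Finsupp

set_option maxHeartbeats 4000000 in
theorem two_to_three {k R A B : Type} [Field k] [Ring R] [Ring A] [Ring B] [Algebra k R]
    [Algebra k A] [Algebra k B] (ℛ : ℤ → Submodule k R) (𝒜 : ℤ → Submodule k A)
    (ℬ : ℤ → Submodule k B) [GradedAlgebra ℬ] (hconn : ℬ 0 = Submodule.span k {(1 : B)})
    (hpos : ∀ n : ℤ, n < 0 → ℬ n = ⊥) [IsNoetherianRing B]
    (φ : A →ₐ[k] R) (ψ : B →ₐ[k] R) (ρ : R →ₐ[k] A) (hρφ : ∀ a, ρ (φ a) = a)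
    (hρψ : ∀ b ∈ posSet ℬ, ρ (ψ b) = 0) (hcomm : ∀ a b, φ a * ψ b = ψ b * φ a)
    (hspan : AddSubgroup.closure {x : R | ∃ a b, x = φ a * ψ b} = ⊤)
    (hproj : @Module.Projective B _ R _ (Module.compHom R ψ.toRingHom))
    (h0 : ∀ c : k, algebraMap k R c ∈ ℛ 0) (hφ : ∀ i, ∀ a ∈ 𝒜 i, φ a ∈ ℛ i)
    (hψ : ∀ i, ∀ b ∈ ℬ i, ψ b ∈ ℛ i)
    (h : EpsCondition k R ℛ) : EpsCondition k A 𝒜 := by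
  refine elim h0 h fun M _ _ _ _ F => ?_
  let instR : Module B R := Module.compHom R ψ.toRingHom
  let instB : ∀ n, Module B (M n) := fun n => Module.compHom (M n) ψ.toRingHom
  have hb : ∀ n (b : B) (m : M n), b • m = ψ b • m := fun _ _ _ => rfl
  have hprojB : ∀ n, Module.Projective B (M n) := fun n =>
    res_proj ψ.toRingHom (hb n) (fun _ _ => rfl) hproj (F.proj n)
  let dB : ∀ i j, M i →ₗ[B] M j := fun i j => resL ψ.toRingHom (hb i) (hb j) (F.d i j)
  have hkR : ∀ n (c : k) (m : M n), algebraMap k R c • m = c • m := fun n c m =>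
    algebraMap_smul R c m
  -- degrees
  have hcR : ∀ n p, ∀ r ∈ ℛ p, ∀ m i, F.δ n (r • m) (p + i) = r • F.δ n m i := by
    intro n p r hr m i
    exact (F.gr n).coord (δ' := (F.δ n).toAddMonoidHom) (DistribSMul.toAddMonoidHom (M n) r)
      (p + ·) (fun _ _ h => add_left_cancel h) (fun j s hs => F.smul n p j r s hr hs) m i
  have hcB : ∀ n p, ∀ b ∈ ℬ p, ∀ m i, F.δ n (b • m) (p + i) = b • F.δ n m i :=
    fun n p b hbp m i => hcR n p (ψ b) (hψ p b hbp) m i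
  have hcd : ∀ i j m e, F.δ j (F.d i j m) e = F.d i j (F.δ i m e) := by
    intro i j m e
    exact (F.gr i).coord (δ' := (F.δ j).toAddMonoidHom) (F.d i j).toAddMonoidHom
      (fun e => e) Function.injective_id (fun e s hs => F.dδ i j e s hs) m e
  -- the submodules
  have hφJ : ∀ n a (m : M n), m ∈ JM (posSet ℬ) (M n) → φ a • m ∈ JM (posSet ℬ) (M n) := by
    intro n a m hm
    let u : M n →ₗ[B] M n :=
      { toFun := fun m => φ a • m
        map_add' := smul_add _
        map_smul' := fun b m => by
          change φ a • ψ b • m = ψ b • φ a • m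
          rw [smul_smul, smul_smul, hcomm] }
    exact JM_map _ u m hm
  let N : ∀ n, Submodule R (M n) := fun n =>
    { carrier := JM (posSet ℬ) (M n)
      zero_mem' := zero_mem _
      add_mem' := add_mem
      smul_mem' := by
        intro r m hm
        have hr : r ∈ AddSubgroup.closure {x : R | ∃ a b, x = φ a * ψ b} := by
          rw [hspan]; trivial
        induction hr using AddSubgroup.closure_induction with
        | mem x hx =>
          obtain ⟨a, b, rfl⟩ := hx
          rw [mul_smul]
          exact hφJ n a _ (Submodule.smul_mem (JM (posSet ℬ) (M n)) b hm)
        | zero => rw [zero_smul]; exact zero_mem (JM (posSet ℬ) (M n))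
        | add x y _ _ hx hy => rw [add_smul]; exact add_mem (S := Submodule B (M n)) hx hy
        | neg x _ hx => rw [neg_smul]; exact neg_mem (S := Submodule B (M n)) hx }
  have hN : ∀ n m, m ∈ N n ↔ m ∈ JM (posSet ℬ) (M n) := fun _ _ => Iff.rfl
  have hNN : ∀ i j m, m ∈ N i → F.d i j m ∈ N j := fun i j m hm =>
    JM_map (posSet ℬ) (dB i j) m hm
  let Q : ℤ → Type := fun n => M n ⧸ N n
  let instA : ∀ n, Module A (Q n) := fun n => Module.compHom (M n ⧸ N n) φ.toRingHom
  let π : ∀ n, M n →ₗ[R] Q n := fun n => (N n).mkQ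
  have hπs : ∀ n, Function.Surjective (π n) := fun n => (N n).mkQ_surjective
  have hπ0 : ∀ n m, π n m = 0 ↔ m ∈ JM (posSet ℬ) (M n) := fun n m =>
    (Submodule.Quotient.mk_eq_zero (N n)).trans (hN n m)
  have ha : ∀ n (a : A) (q : Q n), a • q = φ a • q := fun _ _ _ => rfl
  let πk : ∀ n, M n →ₗ[k] Q n := fun n => (π n).restrictScalars k
  choose δ' hgr hδ' hlift using fun n => quot_gr (πk n) (hπs n) (F.δ n) (F.gr n) (by
    intro m hm i
    exact (hπ0 n _).2 (JM_stable ℬ (F.δ n).toAddMonoidHom (hcB n) m ((hπ0 n m).1 hm) i))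
  -- reduction of scalars
  have hψπ : ∀ n b (m : M n), ∃ c : k, π n (ψ b • m) = c • π n m ∧ ρ (ψ b) = algebraMap k A c := by
    intro n b m
    obtain ⟨c, hc⟩ := pos_split ℬ hconn hpos b
    refine ⟨c, ?_, ?_⟩
    · have h1 := (hπ0 n _).2 (closure_smul_JM _ _ hc m)
      rw [sub_smul, map_sub, sub_eq_zero, hb, hb] at h1
      rw [h1, AlgHom.commutes, hkR]
      exact (πk n).map_smul c m
    · have h1 : ρ (ψ (b - algebraMap k B c)) = 0 := by
        generalize b - algebraMap k B c = x at hc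
        induction hc using AddSubgroup.closure_induction with
        | mem x hx => exact hρψ x hx
        | zero => simp
        | add x y _ _ hx hy => rw [map_add, map_add, hx, hy, add_zero]
        | neg x _ hx => rw [map_neg, map_neg, hx, neg_zero]
      rw [map_sub, map_sub, sub_eq_zero] at h1
      rw [h1, AlgHom.commutes, AlgHom.commutes]
  have hk : ∀ n (c : k) (q : Q n), algebraMap k A c • q = c • q := by
    intro n c q
    rw [ha, AlgHom.commutes]
    exact algebraMap_smul R c q
  have hρπ : ∀ n r (m : M n), π n (r • m) = ρ r • π n m := by
    intro n r m
    have hr : r ∈ AddSubgroup.closure {x : R | ∃ a b, x = φ a * ψ b} := by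
      rw [hspan]; trivial
    induction hr using AddSubgroup.closure_induction with
    | mem x hx =>
      obtain ⟨a, b, rfl⟩ := hx
      obtain ⟨c, h1, h2⟩ := hψπ n b m
      rw [mul_smul, map_smul, h1, map_mul, h2, hρφ, mul_smul, hk, ha]
    | zero => rw [zero_smul, map_zero, map_zero, zero_smul]
    | add x y _ _ hx hy => rw [add_smul, map_add, hx, hy, map_add, add_smul]
    | neg x _ hx => rw [neg_smul, map_neg, hx, map_neg, neg_smul]
  have hρf : ∀ n (f : M n →ₗ[R] R) m, π n m = 0 → ρ (f m) = 0 := by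
    intro n f m hm
    have h1 := JM_map (posSet ℬ) (resL ψ.toRingHom (hb n) (fun _ _ => rfl) f : M n →ₗ[B] R) m
      ((hπ0 n m).1 hm)
    change f m ∈ _ at h1
    generalize f m = x at h1
    induction h1 using Submodule.span_induction with
    | mem x hx =>
      obtain ⟨b, hb, m, rfl⟩ := hx
      change ρ (ψ b * m) = 0
      rw [map_mul, hρψ b hb, zero_mul]
    | zero => simp
    | add x y _ _ hx hy => rw [map_add, hx, hy, add_zero]
    | smul c x _ hx =>
      change ρ (ψ c * x) = 0
      rw [map_mul, hx, mul_zero]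
  have hQ : ∀ n, Module.Projective A (Q n) ∧ Module.Finite A (Q n) := fun n =>
    quot_proj ρ.toRingHom (fun a => ⟨φ a, hρφ a⟩) (π n).toAddMonoidHom (hπs n) (hρπ n)
      (hρf n) (F.proj n) (F.fin n)
  let dQ : ∀ i j, Q i →ₗ[A] Q j := fun i j =>
    resL φ.toRingHom (ha i) (ha j) ((N i).mapQ (N j) (F.d i j) (hNN i j))
  have hdQ : ∀ i j m, dQ i j (π i m) = π j (F.d i j m) := fun i j m => rfl
  have hhom : ∀ n j m, F.δ n m = single j m → δ' n (π n m) = single j (π n m) := by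
    intro n j m hm
    ext e
    rw [show δ' n (π n m) e = _ from hδ' n m e, hm]
    change π n _ = _
    rw [single_apply, single_apply]
    split_ifs
    · rfl
    · exact map_zero _
  obtain ⟨N₀, hN₀⟩ := F.bdd
  have hfg : ∀ n, ∃ (r : ℕ) (f : (Fin r → B) →ₗ[B] M (n + 1)),
      (∀ p, dB (n + 1) (n + 1 + 1) (f p) = 0) ∧
      ∀ z, dB (n + 1) (n + 1 + 1) z = 0 → ∃ p y, z = f p + dB n (n + 1) y := by
    intro n
    obtain ⟨r, w, hw, hw'⟩ := (F.finH n (n + 1) (n + 1 + 1) rfl rfl).cycles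
    refine ⟨r, Fintype.linearCombination B w, ?_, ?_⟩
    · intro p
      rw [Fintype.linearCombination_apply, map_sum]
      refine Finset.sum_eq_zero fun i _ => ?_
      rw [map_smul, show dB (n + 1) (n + 1 + 1) (w i) = 0 from hw i, smul_zero]
    · intro z hz
      obtain ⟨c, y, h⟩ := hw' z hz
      refine ⟨fun i => algebraMap k B (c i), y, ?_⟩
      rw [Fintype.linearCombination_apply, h]
      congr 1
      refine Finset.sum_congr rfl fun i _ => ?_
      rw [hb, AlgHom.commutes]
  have hNbd : ∀ n, (N₀ : ℤ) < n → Subsingleton (M n) := fun n hn =>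
    hN₀ n (lt_of_lt_of_le hn (le_abs_self n))
  refine Fam.intro (M := Q)
    { d := dQ, shape := ?_, dd := ?_, bdd := ⟨N₀, ?_⟩, proj := fun n => (hQ n).1, fin := fun n => (hQ n).2
      δ := δ', gr := hgr, smul := ?_, dδ := ?_, finH := ?_, nz := ?_ }
  · intro i j hij
    refine LinearMap.ext fun q => ?_
    obtain ⟨m, rfl⟩ := hπs i q
    rw [hdQ, F.shape i j hij]
    exact map_zero _
  · intro i j l q
    obtain ⟨m, rfl⟩ := hπs i q
    rw [hdQ, hdQ, F.dd, map_zero]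
  · intro n hn
    have := hN₀ n hn
    exact (hπs n).subsingleton
  · intro n i j a q haa hq
    obtain ⟨m, hm, hm'⟩ := hlift n q j hq
    have h1 : a • q = π n (φ a • m) := by
      rw [map_smul, ← ha]
      exact congrArg (a • ·) hm.symm
    rw [h1]
    exact hhom n _ _ (F.smul n i j _ m (hφ i a haa) hm')
  · intro n n' i q hq
    obtain ⟨m, hm, hm'⟩ := hlift n q i hq
    have h1 : dQ n n' q = π n' (F.d n n' m) := by
      rw [← hdQ]
      exact congrArg _ hm.symm
    rw [h1]
    exact hhom n' _ _ (F.dδ n n' i m hm')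
  · intro n j l hij hjl
    subst hij hjl
    obtain ⟨V, ⟨S, hS⟩, hV⟩ := key (posSet ℬ) (N₀ - n).toNat M (fun n => dB n (n + 1))
      (fun n x => F.dd _ _ _ x) hprojB N₀ N₀ hNbd (fun n hn z hz => by
        have := hNbd (n + 1) hn
        exact ⟨0, Subsingleton.elim _ _⟩) hfg n (by omega)
    let e := S.equivFin
    refine ⟨S.card, fun i => π (n + 1) (e.symm i).1, fun q hq => ?_⟩
    obtain ⟨m, rfl⟩ := hπs _ q
    rw [hdQ] at hq
    obtain ⟨x, hx, y, v, hv, rfl⟩ := hV m ((hπ0 _ _).1 hq)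
    have hv' : ∃ c : Fin S.card → k, π (n + 1) v = ∑ i, c i • π (n + 1) (e.symm i).1 := by
      rw [← hS] at hv
      have hr : (S : Set (M (n + 1))) = Set.range fun i => (e.symm i).1 := by
        ext x
        constructor
        · intro hx
          exact ⟨e ⟨x, hx⟩, by simp⟩
        · rintro ⟨i, rfl⟩
          exact (e.symm i).2
      rw [hr, Submodule.mem_span_range_iff_exists_fun] at hv
      obtain ⟨b, rfl⟩ := hv
      choose c hc _ using fun i => hψπ (n + 1) (b i) (e.symm i).1
      refine ⟨c, ?_⟩
      rw [map_sum]
      exact Finset.sum_congr rfl fun i _ => hc i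
    obtain ⟨c, hc⟩ := hv'
    refine ⟨c, π n y, ?_⟩
    rw [map_add, map_add, hc, (hπ0 _ x).2 hx, zero_add, hdQ, add_comm (π (n + 1) (dB n (n + 1) y))]
    congr 1
    exact Finset.sum_congr rfl fun i _ => (hk _ _ _).symm
  · by_contra hcon
    push Not at hcon
    let P : ℤ → Prop := fun t => ∃ z, F.d (t + 1) (t + 1 + 1) z = 0 ∧ ∀ y, F.d t (t + 1) y ≠ z
    have hP : ∃ t, P t := by
      obtain ⟨i, j, l, rfl, rfl, h⟩ := F.nz
      exact ⟨i, h⟩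
    have hPb : ∀ t, P t → t ≤ N₀ := by
      rintro t ⟨z, hz, hy⟩
      by_contra hlt
      have := hNbd (t + 1) (by omega)
      exact hy 0 (Subsingleton.elim _ _)
    obtain ⟨t, ⟨z₀, hz₀, hy₀⟩, hmax⟩ := Int.exists_greatest_of_bdd ⟨N₀, hPb⟩ hP
    obtain ⟨s, hs⟩ := exists_split M (fun n => dB n (n + 1)) (fun n x => F.dd _ _ _ x) hprojB
      N₀ (t + 1) hNbd (by
        intro n hn z hz
        by_contra hy
        push Not at hy
        have := hmax n ⟨z, hz, hy⟩
        omega) (t + 1) le_rfl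
    have step : ∀ z, F.d (t + 1) (t + 1 + 1) z = 0 → ∀ e, ∃ y, F.d t (t + 1) y = F.δ (t + 1) z e := by
      obtain ⟨r, w, hw⟩ := F.finH t (t + 1) (t + 1 + 1) rfl rfl
      let E : Finset ℤ := Finset.univ.biUnion fun i => (F.δ (t + 1) (w i)).support
      obtain ⟨e₀, he₀⟩ : ∃ e₀ : ℤ, ∀ e ∈ E, e₀ ≤ e := by
        obtain ⟨e₀, he₀⟩ := E.bddBelow
        exact ⟨e₀, fun e he => he₀ he⟩
      refine nak ℬ hpos (dB t (t + 1)) (dB (t + 1) (t + 1 + 1)) (F.δ t).toAddMonoidHom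
        (F.δ (t + 1)).toAddMonoidHom (hcB (t + 1)) (hcd t (t + 1)) e₀ ?_ ?_
      · intro z hz e he
        obtain ⟨c, y, h⟩ := hw z hz
        refine ⟨F.δ t y e, ?_⟩
        change F.d t (t + 1) _ = F.δ (t + 1) z e
        rw [← hcd, h, map_add, map_sum, Finsupp.add_apply, Finsupp.finsetSum_apply,
          Finset.sum_eq_zero, zero_add]
        intro i _
        rw [hkR, map_smul, Finsupp.smul_apply]
        have : e ∉ (F.δ (t + 1) (w i)).support := fun hh =>
          absurd (he₀ e (Finset.mem_biUnion.2 ⟨i, Finset.mem_univ _, hh⟩)) (by omega)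
        rw [Finsupp.notMem_support_iff.1 this, smul_zero]
      · intro z hz
        obtain ⟨q, hq⟩ := hcon t (t + 1) (t + 1 + 1) rfl rfl (π _ z) (by
          rw [hdQ, show F.d (t + 1) (t + 1 + 1) z = 0 from hz, map_zero])
        obtain ⟨y, rfl⟩ := hπs t q
        rw [hdQ, ← sub_eq_zero, ← map_sub, hπ0] at hq
        let g := dB (t + 1) (t + 1 + 1)
        let rr : M (t + 1) →ₗ[B] LinearMap.ker g :=
          (LinearMap.id - s ∘ₗ g).codRestrict _ (fun x => by
            change g (x - s (g x)) = 0
            rw [map_sub, sub_eq_zero]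
            exact (hs x).symm)
        have h1 := JM_map _ rr _ hq
        refine ⟨y, -rr (F.d t (t + 1) y - z), neg_mem h1, ?_⟩
        have h2 : (rr (F.d t (t + 1) y - z)).1 = F.d t (t + 1) y - z := by
          change (F.d t (t + 1) y - z) - s (g (F.d t (t + 1) y - z)) = _
          have h3 : g (F.d t (t + 1) y - z) = 0 := by
            rw [map_sub, hz, sub_zero]
            exact F.dd _ _ _ _
          rw [h3, map_zero, sub_zero]
        rw [Submodule.coe_neg, h2]
        change z = F.d t (t + 1) y + _
        abel
    choose y hy using step z₀ hz₀
    refine hy₀ (∑ e ∈ (F.δ (t + 1) z₀).support, y e) ?_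
    rw [map_sum]
    simp only [hy]
    exact (F.gr (t + 1)).sum z₀

end EpsAux

namespace EpsAux
open Finsupp TensorProduct

theorem exists_eps {k B : Type} [Field k] [Ring B] [Algebra k B] [Nontrivial B]
    (ℬ : ℤ → Submodule k B)
    [GradedAlgebra ℬ] (hconn : ℬ 0 = Submodule.span k {(1 : B)})
    (hpos : ∀ n : ℤ, n < 0 → ℬ n = ⊥) :
    ∃ ε : B →ₐ[k] k, ∀ b ∈ posSet ℬ, ε b = 0 := by
  classical
  let p : B →ₗ[k] B := GradedAlgebra.proj ℬ 0
  have hp0 : ∀ i, ∀ b ∈ ℬ i, i ≠ 0 → p b = 0 := by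
    intro i b hb hi
    change ((DirectSum.decompose ℬ b) 0 : B) = 0
    exact DirectSum.decompose_of_mem_ne ℬ hb hi
  have hp1 : ∀ b ∈ ℬ 0, p b = b := by
    intro b hb
    exact DirectSum.decompose_of_mem_same ℬ hb
  have hz : ∀ i, i < 0 → ∀ b ∈ ℬ i, b = 0 := by
    intro i hi b hb
    rw [hpos i hi] at hb
    simpa using hb
  have hmul : ∀ a b, p (a * b) = p a * p b := by
    intro a b
    induction a using DirectSum.Decomposition.inductionOn ℬ with
    | zero => simp
    | add x y hx hy => rw [add_mul, map_add, hx, hy, map_add, add_mul]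
    | @homogeneous i x =>
      induction b using DirectSum.Decomposition.inductionOn ℬ with
      | zero => simp
      | add x y hx hy => rw [mul_add, map_add, hx, hy, map_add, mul_add]
      | @homogeneous j y =>
        have hxy : (x : B) * y ∈ ℬ (i + j) := SetLike.mul_mem_graded x.2 y.2
        rcases lt_trichotomy i 0 with hi | hi | hi
        · rw [hz i hi x x.2]; simp
        · by_cases hj : j = 0
          · subst hi hj
            rw [hp1 _ x.2, hp1 _ y.2, hp1 _ (by simpa using hxy)]
          · rw [hp0 j y y.2 hj, mul_zero, hp0 (i + j) _ hxy (by omega)]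
        · rcases lt_or_ge j 0 with hj | hj
          · rw [hz j hj y y.2]; simp
          · rw [hp0 i x x.2 (by omega), zero_mul, hp0 (i + j) _ hxy (by omega)]
  have hone : p 1 = 1 := hp1 1 SetLike.GradedOne.one_mem
  let P : B →ₐ[k] B := AlgHom.ofLinearMap p hone hmul
  have hinj : Function.Injective (Algebra.ofId k B) := (algebraMap k B).injective
  have hr : ∀ b, P b ∈ (Algebra.ofId k B).range := by
    intro b
    have h1 : P b ∈ ℬ 0 := (DirectSum.decompose ℬ b 0).2
    rw [hconn, Submodule.mem_span_singleton] at h1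
    obtain ⟨c, hc⟩ := h1
    refine ⟨c, ?_⟩
    rw [← hc]
    exact Algebra.algebraMap_eq_smul_one c
  let e := AlgEquiv.ofInjective _ hinj
  refine ⟨e.symm.toAlgHom.comp (P.codRestrict _ hr), ?_⟩
  rintro b ⟨i, hi, hb⟩
  have h1 : P.codRestrict _ hr b = 0 := Subtype.ext (hp0 i b hb (by omega))
  change e.symm (P.codRestrict _ hr b) = 0
  rw [h1, map_zero]

theorem nontrivial_of_eps {k R : Type} [Field k] [Ring R] [Algebra k R] {ι : Type}
    [AddCommGroup ι] [DecidableEq ι] {ℛ : ι → Submodule k R}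
    (h0 : ∀ c : k, algebraMap k R c ∈ ℛ 0) (h : EpsCondition k R ℛ) : Nontrivial R := by
  refine elim h0 h fun M _ _ _ _ F => ?_
  by_contra hn
  rw [not_nontrivial_iff_subsingleton] at hn
  obtain ⟨i, j, l, _, _, z, _, hy⟩ := F.nz
  have := Module.subsingleton R (M j)
  exact hy 0 (Subsingleton.elim _ _)

section
variable {k A B : Type} [Field k] [Ring A] [Ring B] [Algebra k A] [Algebra k B]

theorem closure_tmul : AddSubgroup.closure {x : A ⊗[k] B | ∃ a b, x = a ⊗ₜ[k] b} = ⊤ := by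
  rw [eq_top_iff]
  rintro x -
  induction x using TensorProduct.induction_on with
  | zero => exact zero_mem _
  | tmul a b => exact AddSubgroup.subset_closure ⟨a, b, rfl⟩
  | add x y hx hy => exact add_mem hx hy

theorem proj_right : @Module.Projective B _ (A ⊗[k] B) _ (Module.compHom (A ⊗[k] B)
    (Algebra.TensorProduct.includeRight : B →ₐ[k] A ⊗[k] B).toRingHom) := by
  let inst : Module B (A ⊗[k] B) := Module.compHom (A ⊗[k] B)
    (Algebra.TensorProduct.includeRight : B →ₐ[k] A ⊗[k] B).toRingHom
  have hs : ∀ (b : B) (x : A ⊗[k] B), b • x = (1 ⊗ₜ[k] b) * x := fun _ _ => rfl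
  let e : B ⊗[k] A ≃ₗ[B] A ⊗[k] B :=
    { TensorProduct.comm k B A with
      map_smul' := by
        intro b x
        change TensorProduct.comm k B A (b • x) = b • TensorProduct.comm k B A x
        induction x using TensorProduct.induction_on with
        | zero => simp
        | tmul b' a => simp [hs, TensorProduct.smul_tmul']
        | add x y hx hy => rw [smul_add, map_add, hx, hy, map_add, smul_add] }
  exact Module.Projective.of_equiv' e

theorem proj_left : @Module.Projective A _ (A ⊗[k] B) _ (Module.compHom (A ⊗[k] B)
    (Algebra.TensorProduct.includeLeft : A →ₐ[k] A ⊗[k] B).toRingHom) := by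
  have h : Module.Projective A (A ⊗[k] B) := inferInstance
  convert h
  refine Module.ext' _ _ fun a x => ?_
  change (a ⊗ₜ[k] 1) * x = a • x
  induction x using TensorProduct.induction_on with
  | zero => simp
  | tmul b' a => simp [TensorProduct.smul_tmul']
  | add x y hx hy => rw [smul_add, mul_add, hx, hy]

theorem two_three (𝒜 : ℤ → Submodule k A) [GradedAlgebra 𝒜]
    (ℬ : ℤ → Submodule k B) [GradedAlgebra ℬ]
    (hconnA : 𝒜 0 = Submodule.span k {(1 : A)})
    (hposA : ∀ n : ℤ, n < 0 → 𝒜 n = ⊥)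
    (hconnB : ℬ 0 = Submodule.span k {(1 : B)})
    (hposB : ∀ n : ℤ, n < 0 → ℬ n = ⊥)
    [IsNoetherianRing (A ⊗[k] B)] (ℛ : ℤ → Submodule k (A ⊗[k] B))
    (hℛ : ∀ i j, ∀ a ∈ 𝒜 i, ∀ b ∈ ℬ j, a ⊗ₜ[k] b ∈ ℛ (i + j))
    (h : EpsCondition k (A ⊗[k] B) ℛ) : EpsCondition k A 𝒜 ∧ EpsCondition k B ℬ := by
  have hA0 : ∀ c : k, algebraMap k A c ∈ 𝒜 0 := fun c => by
    rw [Algebra.algebraMap_eq_smul_one]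
    exact Submodule.smul_mem _ _ SetLike.GradedOne.one_mem
  have h0 : ∀ c : k, algebraMap k (A ⊗[k] B) c ∈ ℛ 0 := fun c => by
    have := hℛ 0 0 _ (hA0 c) 1 SetLike.GradedOne.one_mem
    rw [add_zero] at this
    exact this
  have hnt := nontrivial_of_eps h0 h
  have hA : Nontrivial A := by
    by_contra hn
    rw [not_nontrivial_iff_subsingleton] at hn
    exact not_subsingleton (A ⊗[k] B) (subsingleton_of_zero_eq_one (by
      rw [Algebra.TensorProduct.one_def, Subsingleton.elim (1 : A) 0, zero_tmul]))
  have hB : Nontrivial B := by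
    by_contra hn
    rw [not_nontrivial_iff_subsingleton] at hn
    exact not_subsingleton (A ⊗[k] B) (subsingleton_of_zero_eq_one (by
      rw [Algebra.TensorProduct.one_def, Subsingleton.elim (1 : B) 0, tmul_zero]))
  obtain ⟨εA, hεA⟩ := exists_eps 𝒜 hconnA hposA
  obtain ⟨εB, hεB⟩ := exists_eps ℬ hconnB hposB
  let ρA : A ⊗[k] B →ₐ[k] A := (Algebra.TensorProduct.rid k k A).toAlgHom.comp
    (Algebra.TensorProduct.map (AlgHom.id k A) εB)
  let ρB : A ⊗[k] B →ₐ[k] B := (Algebra.TensorProduct.lid k B).toAlgHom.comp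
    (Algebra.TensorProduct.map εA (AlgHom.id k B))
  have hρA : ∀ a b, ρA (a ⊗ₜ b) = εB b • a := fun a b => by simp [ρA]
  have hρB : ∀ a b, ρB (a ⊗ₜ b) = εA a • b := fun a b => by simp [ρB]
  have nA : IsNoetherianRing A := isNoetherianRing_of_surjective _ _ ρA.toRingHom
    (fun a => ⟨a ⊗ₜ 1, by simpa using hρA a 1⟩)
  have nB : IsNoetherianRing B := isNoetherianRing_of_surjective _ _ ρB.toRingHom
    (fun a => ⟨1 ⊗ₜ a, by simpa using hρB 1 a⟩)
  constructor
  · refine two_to_three ℛ 𝒜 ℬ hconnB hposB Algebra.TensorProduct.includeLeft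
      Algebra.TensorProduct.includeRight ρA ?_ ?_ ?_ ?_ proj_right h0 ?_ ?_ h
    · intro a; simp [hρA]
    · intro b hb; simp [hρA, hεB b hb]
    · intro a b; simp
    · convert closure_tmul (k := k) (A := A) (B := B) using 6; simp
    · intro i a ha
      simpa using hℛ i 0 a ha 1 SetLike.GradedOne.one_mem
    · intro i b hb
      simpa using hℛ 0 i 1 SetLike.GradedOne.one_mem b hb
  · refine two_to_three ℛ ℬ 𝒜 hconnA hposA Algebra.TensorProduct.includeRight
      Algebra.TensorProduct.includeLeft ρB ?_ ?_ ?_ ?_ proj_left h0 ?_ ?_ h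
    · intro a; simp [hρB]
    · intro b hb; simp [hρB, hεA b hb]
    · intro a b; simp
    · have : {x : A ⊗[k] B | ∃ (a : B) (b : A), x = (Algebra.TensorProduct.includeRight : B →ₐ[k] A ⊗[k] B) a *
          (Algebra.TensorProduct.includeLeft : A →ₐ[k] A ⊗[k] B) b} =
          {x : A ⊗[k] B | ∃ a b, x = a ⊗ₜ[k] b} := by
        ext x
        simp only [Set.mem_setOf_eq, Algebra.TensorProduct.includeRight_apply,
          Algebra.TensorProduct.includeLeft_apply, Algebra.TensorProduct.tmul_mul_tmul, one_mul,
          mul_one]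
        exact exists_comm
      rw [this]
      exact closure_tmul
    · intro i b hb
      simpa using hℛ 0 i 1 SetLike.GradedOne.one_mem b hb
    · intro i a ha
      simpa using hℛ i 0 a ha 1 SetLike.GradedOne.one_mem

end
end EpsAux

namespace EpsAux
open Finsupp

theorem FinH.of_sub {k A M' M M'' : Type} [Field k] [Ring A] [Algebra k A] [AddCommGroup M']
    [AddCommGroup M] [AddCommGroup M''] [Module A M'] [Module A M] [Module A M''] [Module k M]
    [IsScalarTower k A M] {f : M' →ₗ[A] M} {g : M →ₗ[A] M''} (V : Submodule k M) (hV : V.FG)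
    (h : ∀ z, g z = 0 → ∃ v ∈ V, ∃ y, z = v + f y) : FinH k f g := by
  obtain ⟨r, w, rfl⟩ := Submodule.fg_iff_exists_fin_generating_family.1 hV
  refine ⟨r, w, fun z hz => ?_⟩
  obtain ⟨v, hv, y, rfl⟩ := h z hz
  obtain ⟨c, rfl⟩ := (Submodule.mem_span_range_iff_exists_fun k).1 hv
  exact ⟨c, y, by simp⟩

theorem FinH.sub {k A M' M M'' : Type} [Field k] [Ring A] [Algebra k A] [AddCommGroup M']
    [AddCommGroup M] [AddCommGroup M''] [Module A M'] [Module A M] [Module A M''] [Module k M]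
    [IsScalarTower k A M] {f : M' →ₗ[A] M} {g : M →ₗ[A] M''} (h : FinH k f g) :
    ∃ V : Submodule k M, V.FG ∧ ∀ z, g z = 0 → ∃ v ∈ V, ∃ y, z = v + f y := by
  obtain ⟨r, w, h⟩ := h
  refine ⟨Submodule.span k (Set.range w), Submodule.fg_span (Set.finite_range w), fun z hz => ?_⟩
  obtain ⟨c, y, rfl⟩ := h z hz
  exact ⟨_, (Submodule.mem_span_range_iff_exists_fun k).2 ⟨c, rfl⟩, y, by simp⟩

/-- Total version of `Fam`. -/
structure Tot (k : Type) [Field k] (A : Type) [Ring A] [Algebra k A]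
    {ι : Type} [AddCommGroup ι] (𝒜 : ι → Submodule k A) (T : Type)
    [AddCommGroup T] [Module k T] [Module A T] where
  d : T →ₗ[A] T
  dd : ∀ x, d (d x) = 0
  proj : Module.Projective A T
  fin : Module.Finite A T
  Δ : T →ₗ[k] (ι × ℤ →₀ T)
  gr : IsGr Δ.toAddMonoidHom
  smul : ∀ i e a t, a ∈ 𝒜 i → Δ t = single e t → Δ (a • t) = single (i + e.1, e.2) (a • t)
  dΔ : ∀ e t, Δ t = single e t → Δ (d t) = single (e.1, e.2 + 1) (d t)
  finH : FinH k d d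
  nz : ∃ z, d z = 0 ∧ ∀ y, d y ≠ z

theorem Tot.eps {k : Type} [Field k] {A : Type} [Ring A] [Algebra k A]
    {ι : Type} [AddCommGroup ι] [DecidableEq ι] {𝒜 : ι → Submodule k A} {T : Type}
    [AddCommGroup T] [Module k T] [Module A T] [IsScalarTower k A T]
    (hA : AddSubgroup.closure {a : A | ∃ i, a ∈ 𝒜 i} = ⊤)
    (F : Tot k A 𝒜 T) : EpsCondition k A 𝒜 := by
  let Θ : T →ₗ[k] (ℤ →₀ T) := collapse Prod.snd F.Δ
  have hΘ : IsGr Θ.toAddMonoidHom := collapse_gr _ _ F.gr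
  have hΘΔ : ∀ e t, F.Δ t = single e t → Θ t = single e.2 t := by
    intro e t h
    simp [Θ, collapse, h, Finsupp.mapDomain_single]
  have hΘs : ∀ (a : A) t n, Θ (a • t) n = a • Θ t n := by
    intro a t n
    have ha : a ∈ AddSubgroup.closure {a : A | ∃ i, a ∈ 𝒜 i} := by rw [hA]; trivial
    induction ha using AddSubgroup.closure_induction with
    | mem a ha =>
      obtain ⟨i, hi⟩ := ha
      exact hΘ.coord (δ' := Θ.toAddMonoidHom) (DistribSMul.toAddMonoidHom T a) (fun n => n)
        Function.injective_id (fun n s hs => collapse_deg Prod.snd F.Δ F.Δ F.gr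
          (DistribSMul.toAddMonoidHom T a) (fun e => (i + e.1, e.2)) (fun n => n) (fun _ => rfl)
          (fun e t ht => F.smul i e a t hi ht) n s hs) t n
    | zero => simp
    | add x y _ _ hx hy => rw [add_smul, map_add, Finsupp.add_apply, hx, hy, add_smul]
    | neg x _ hx => rw [neg_smul, map_neg, Finsupp.neg_apply, hx, neg_smul]
  have hΘd : ∀ t n, Θ (F.d t) (n + 1) = F.d (Θ t n) := by
    intro t n
    exact hΘ.coord (δ' := Θ.toAddMonoidHom) F.d.toAddMonoidHom (fun n => n + 1)
        (add_left_injective 1) (fun n s hs => collapse_deg Prod.snd F.Δ F.Δ F.gr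
          F.d.toAddMonoidHom (fun e => (e.1, e.2 + 1)) (fun n => n + 1) (fun _ => rfl)
          (fun e t ht => F.dΔ e t ht) n s hs) t n
  let P : ℤ → T →ₗ[A] T := fun n =>
    { toFun := fun t => Θ t n
      map_add' := by simp
      map_smul' := fun a t => hΘs a t n }
  have hPd : ∀ n t, P (n + 1) (F.d t) = F.d (P n t) := fun n t => hΘd t n
  have hPP : ∀ n t, P n (P n t) = P n t := by
    intro n t
    have := hΘ.idem t n
    change Θ (Θ t n) = _ at this
    change Θ (Θ t n) n = Θ t n
    rw [this, single_eq_same]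
    rfl
  have hPP' : ∀ n m t, n ≠ m → P m (P n t) = 0 := by
    intro n m t hnm
    have := hΘ.idem t n
    change Θ (Θ t n) = _ at this
    change Θ (Θ t n) m = 0
    rw [this, single_eq_of_ne' hnm]
  have hPΔ : ∀ e t n, F.Δ t = single e t → P n t = if e.2 = n then t else 0 := by
    intro e t n h
    change Θ t n = _
    rw [hΘΔ e t h, single_apply]
  have hP : ∀ n (x : LinearMap.range (P n)), P n x.1 = x.1 := by
    rintro n ⟨_, t, rfl⟩
    exact hPP n t
  let X : ℤ → Type := fun n => LinearMap.range (P n)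
  let r : ∀ n, T →ₗ[A] X n := fun n => (P n).rangeRestrict
  let ii : ∀ n, X n →ₗ[A] T := fun n => (LinearMap.range (P n)).subtype
  have hiinj : ∀ n, Function.Injective (ii n) := fun n => Subtype.val_injective
  have hri : ∀ n (x : X n), r n (ii n x) = x := fun n x => Subtype.ext (hP n x)
  have hir : ∀ n t, ii n (r n t) = P n t := fun n t => rfl
  have hPi : ∀ n (x : X n), P n (ii n x) = ii n x := fun n x => hP n x
  let δ : ∀ n, X n →ₗ[k] (ι →₀ X n) := fun n =>
    (Finsupp.mapRange.linearMap ((r n).restrictScalars k)).comp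
      ((collapse Prod.fst F.Δ).comp ((ii n).restrictScalars k))
  let S : ∀ n, Set (X n) := fun n => {x | ∃ j, F.Δ (ii n x) = single (j, n) (ii n x)}
  have hS : ∀ n, AddSubgroup.closure (S n) = ⊤ := by
    intro n
    rw [eq_top_iff]
    rintro x -
    obtain ⟨t, rfl⟩ : ∃ t, r n t = x := ⟨ii n x, hri n x⟩
    have ht : t ∈ AddSubgroup.closure {m | ∃ i, F.Δ.toAddMonoidHom m = single i m} := by
      rw [F.gr.closure]; trivial
    induction ht using AddSubgroup.closure_induction with
    | mem t ht =>
      obtain ⟨e, he⟩ := ht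
      change F.Δ t = _ at he
      by_cases hn : e.2 = n
      · refine AddSubgroup.subset_closure (show r n t ∈ S n from ⟨e.1, ?_⟩)
        rw [hir, hPΔ e t n he, if_pos hn, he, ← hn]
      · have : r n t = 0 := hiinj n (by rw [hir, hPΔ e t n he, if_neg hn, map_zero])
        rw [this]
        exact zero_mem _
    | zero => rw [map_zero]; exact zero_mem _
    | add x y _ _ hx hy => rw [map_add]; exact add_mem hx hy
    | neg x _ hx => rw [map_neg]; exact neg_mem hx
  have hδS : ∀ n (x : X n) j, F.Δ (ii n x) = single (j, n) (ii n x) → δ n x = single j x := by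
    intro n x j hx
    have h1 : δ n x = (Finsupp.mapRange.linearMap ((r n).restrictScalars k))
      (Finsupp.mapDomain Prod.fst (F.Δ (ii n x))) := rfl
    rw [h1, hx, Finsupp.mapDomain_single]
    simp only [Finsupp.mapRange.linearMap_apply, Finsupp.mapRange_single,
      LinearMap.restrictScalars_apply]
    rw [hri]
  obtain ⟨V, hV, hVz⟩ := F.finH.sub
  refine Fam.intro (M := X)
    { d := fun i j => (r j).comp (F.d.comp (ii i))
      shape := ?_, dd := ?_, bdd := ?_, proj := ?_, fin := ?_
      δ := δ
      gr := fun n => IsGr.of_gens (S n) (hS n) (fun x ⟨j, hx⟩ => ⟨j, hδS n x j hx⟩)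
      smul := ?_, dδ := ?_, finH := ?_, nz := ?_ }
  · intro i j hij
    refine LinearMap.ext fun x => hiinj j ?_
    change P j (F.d (ii i x)) = 0
    rw [← hPi i x, ← hPd, hPP' _ _ _ hij]
  · intro i j l x
    refine hiinj l ?_
    change P l (F.d (P j (F.d (ii i x)))) = 0
    rw [← hPd]
    by_cases h : j + 1 = l
    · subst h
      rw [F.dd, map_zero, map_zero]
    · exact hPP' _ _ _ h
  · have := F.fin
    obtain ⟨s, g, hg⟩ := Module.Finite.exists_fin (R := A) (M := T)
    let E : Finset ℤ := Finset.univ.biUnion fun i => (Θ (g i)).support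
    refine ⟨∑ e ∈ E, e.natAbs, fun n hn => ?_⟩
    have hnE : n ∉ E := by
      intro hE
      have h1 : n.natAbs ≤ ∑ e ∈ E, e.natAbs :=
        Finset.single_le_sum (f := fun e : ℤ => e.natAbs) (fun _ _ => Nat.zero_le _) hE
      rw [Int.abs_eq_natAbs] at hn
      omega
    have hP0 : P n = 0 := by
      refine LinearMap.ext_on_range hg fun i => ?_
      change Θ (g i) n = 0
      by_contra h
      exact hnE (Finset.mem_biUnion.2 ⟨i, Finset.mem_univ _, Finsupp.mem_support_iff.2 h⟩)
    refine ⟨fun x y => hiinj n ?_⟩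
    rw [← hPi n x, ← hPi n y]
    have h0 : ∀ t, P n t = 0 := fun t => LinearMap.congr_fun hP0 t
    exact (h0 _).trans (h0 _).symm
  · intro n
    have := F.proj
    exact Module.Projective.of_split (ii n) (r n) (LinearMap.ext (hri n))
  · intro n
    have := F.fin
    exact Module.Finite.of_surjective (r n) (fun x => ⟨_, hri n x⟩)
  · intro n i j a x ha hx
    refine IsGr.deg_of_gens (δ := (δ n).toAddMonoidHom) (δ' := (δ n).toAddMonoidHom)
      (DistribSMul.toAddMonoidHom (X n) a) (i + ·) (S n) (hS n) ?_ j x hx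
    rintro s ⟨j, hj⟩
    refine ⟨j, hδS n s j hj, hδS n _ _ ?_⟩
    exact F.smul i (j, n) a (ii n s) ha hj
  · intro n n' i x hx
    refine IsGr.deg_of_gens (δ := (δ n).toAddMonoidHom) (δ' := (δ n').toAddMonoidHom)
      ((r n').comp (F.d.comp (ii n))).toAddMonoidHom (fun i => i) (S n) (hS n) ?_ i x hx
    rintro s ⟨j, hj⟩
    refine ⟨j, hδS n s j hj, hδS n' _ _ ?_⟩
    have h1 := F.dΔ _ _ hj
    change F.Δ (P n' (F.d (ii n s))) = single _ (P n' (F.d (ii n s)))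
    rw [hPΔ _ _ n' h1]
    split_ifs with h
    · rw [h1]
      dsimp only at h ⊢
      rw [h]
    · simp
  · rintro i _ _ rfl rfl
    refine FinH.of_sub (V.map ((r (i + 1)).restrictScalars k)) (hV.map _) fun z hz => ?_
    have hz' : F.d (ii _ z) = 0 := by
      have := congrArg (ii _) hz
      change P _ (F.d (ii _ z)) = 0 at this
      rw [hPd, hPi] at this
      exact this
    obtain ⟨v, hv, y, h⟩ := hVz _ hz'
    refine ⟨r _ v, ⟨v, hv, rfl⟩, r i y, ?_⟩
    rw [← hri _ z, h, map_add]
    congr 1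
    refine hiinj _ ?_
    change P _ (F.d y) = P _ (F.d (P i y))
    rw [hPd, hPd, hPP]
  · obtain ⟨z, hz, hy⟩ := F.nz
    by_contra hcon
    push Not at hcon
    have h1 : ∀ n, ∃ y, F.d y = P n z := by
      intro n
      obtain ⟨m, rfl⟩ : ∃ m, n = m + 1 := ⟨n - 1, by omega⟩
      obtain ⟨y, hy⟩ := hcon m (m + 1) (m + 1 + 1) rfl rfl (r (m + 1) z) (by
        refine hiinj _ ?_
        change P _ (F.d (P (m + 1) z)) = 0
        rw [← hPd, hz, map_zero, map_zero])
      refine ⟨ii m y, ?_⟩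
      have h2 := congrArg (ii (m + 1)) hy
      change P (m + 1) (F.d (ii m y)) = P (m + 1) z at h2
      rw [← h2, hPd, hPi]
    choose y hy' using h1
    refine hy (∑ n ∈ (Θ z).support, y n) ?_
    rw [map_sum]
    simp only [hy']
    exact hΘ.sum z

end EpsAux

namespace EpsAux
open Finsupp

theorem Fam.tot {k : Type} [Field k] {A : Type} [Ring A] [Algebra k A]
    {ι : Type} [AddCommGroup ι] {𝒜 : ι → Submodule k A} {M : ℤ → Type}
    [∀ n, AddCommGroup (M n)] [∀ n, Module k (M n)] [∀ n, Module A (M n)]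
    [∀ n, IsScalarTower k A (M n)] (F : Fam k A 𝒜 M) {Q : Prop}
    (hQ : ∀ (T : Type) [AddCommGroup T] [Module k T] [Module A T] [IsScalarTower k A T]
      (G : Tot k A 𝒜 T) (σ : T →ₗ[A] T), (∀ x, σ (σ x) = x) → (∀ x, σ (G.d x) = - G.d (σ x)) →
      (∀ e t, G.Δ t = single e t → G.Δ (σ t) = single e (σ t)) →
      ((2 : k) = 0 → ∀ x, σ x = x) → Q) : Q := by
  classical
  have hproj := F.proj
  have hfin := F.fin
  obtain ⟨N, hN⟩ := F.bdd
  let T := DirectSum ℤ M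
  let L : ∀ n, M n →ₗ[A] T := fun n => DirectSum.lof A ℤ M n
  let p : ∀ n, T →ₗ[A] M n := fun n => DirectSum.component A ℤ M n
  have hpL : ∀ n x, p n (L n x) = x := fun n x => DirectSum.component.lof_self A n x
  have hpL' : ∀ n m x, n ≠ m → p m (L n x) = 0 := fun n m x h => DirectSum.of_eq_of_ne n m x h.symm
  let d : T →ₗ[A] T := DirectSum.toModule A ℤ T fun n => (L (n + 1)).comp (F.d n (n + 1))
  have hdL0 : ∀ n x, d (L n x) = L (n + 1) (F.d n (n + 1) x) := fun n x =>
    DirectSum.toModule_lof A n x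
  have hdL : ∀ i j, i + 1 = j → ∀ x, d (L i x) = L j (F.d i j x) := by
    rintro i _ rfl x
    exact hdL0 i x
  have hpd : ∀ i j, i + 1 = j → ∀ t, p j (d t) = F.d i j (p i t) := by
    intro i j hij t
    have : (p j).comp d = (F.d i j).comp (p i) := by
      refine DirectSum.linearMap_ext A fun n => LinearMap.ext fun x => ?_
      change p j (d (L n x)) = F.d i j (p i (L n x))
      rw [hdL0]
      by_cases h : n = i
      · subst h
        subst hij
        rw [hpL, hpL]
      · rw [hpL' _ _ _ h, hpL' _ _ _ (by omega), map_zero]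
    exact LinearMap.congr_fun this t
  let s : ℤ → ℤ := fun n => if Even n then 1 else -1
  have hss : ∀ n, s n * s n = 1 := by intro n; simp only [s]; split_ifs <;> simp
  have hs1 : ∀ n, s (n + 1) = - s n := by
    intro n; simp only [s, Int.even_add_one]; split_ifs <;> simp_all
  let σ : T →ₗ[A] T := DirectSum.toModule A ℤ T fun n => s n • L n
  have hσL : ∀ n x, σ (L n x) = s n • L n x := fun n x => DirectSum.toModule_lof A n x
  let Δ : T →ₗ[k] (ι × ℤ →₀ T) := DirectSum.toModule k ℤ _ fun n =>
    (Finsupp.lmapDomain T k (fun i : ι => (i, n))).comp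
      ((Finsupp.mapRange.linearMap ((L n).restrictScalars k)).comp (F.δ n))
  have hΔ0 : ∀ n x, Δ (L n x) = Finsupp.mapDomain (fun i : ι => (i, n))
      (Finsupp.mapRange.linearMap ((L n).restrictScalars k) (F.δ n x)) := fun n x =>
    DirectSum.toModule_lof k n x
  have hΔ : ∀ n i x, F.δ n x = single i x → Δ (L n x) = single (i, n) (L n x) := by
    intro n i x hx
    rw [hΔ0, hx]
    simp [Finsupp.mapDomain_single]
  let S : Set T := {t | ∃ n i x, F.δ n x = single i x ∧ t = L n x}
  have hS : AddSubgroup.closure S = ⊤ := by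
    rw [eq_top_iff]
    rintro t -
    induction t using DirectSum.induction_on with
    | zero => exact zero_mem _
    | add x y hx hy => exact add_mem hx hy
    | of n x =>
      have hx : x ∈ AddSubgroup.closure {m | ∃ i, (F.δ n).toAddMonoidHom m = single i m} := by
        rw [(F.gr n).closure]; trivial
      change L n x ∈ _
      induction hx using AddSubgroup.closure_induction with
      | mem x hx =>
        obtain ⟨i, hi⟩ := hx
        exact AddSubgroup.subset_closure ⟨n, i, x, hi, rfl⟩
      | zero => rw [map_zero]; exact zero_mem _
      | add x y _ _ hx hy => rw [map_add]; exact add_mem hx hy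
      | neg x _ hx => rw [map_neg]; exact neg_mem hx
  let I : Finset ℤ := Finset.Icc (-N : ℤ) N
  have hI : ∀ n, n ∉ I → Subsingleton (M n) := by
    intro n hn
    refine hN n ?_
    by_contra h
    rw [not_lt, abs_le] at h
    exact hn (Finset.mem_Icc.2 h)
  have hsum : ∀ t : T, t = ∑ n ∈ I, L n (p n t) := by
    intro t
    refine DirectSum.ext_component A fun m => ?_
    change p m t = p m (∑ n ∈ I, L n (p n t))
    by_cases hm : m ∈ I
    · rw [map_sum, Finset.sum_eq_single m]
      · rw [hpL]
      · intro b _ hb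
        exact hpL' _ _ _ hb
      · exact fun h => absurd hm h
    · have := hI m hm
      exact Subsingleton.elim _ _
  have hLext : ∀ {f g : T →ₗ[A] T}, (∀ n x, f (L n x) = g (L n x)) → ∀ t, f t = g t := by
    intro f g h t
    exact LinearMap.congr_fun (DirectSum.linearMap_ext A fun n => LinearMap.ext fun x => h n x) t
  refine hQ T
    { d := d, dd := ?_, proj := ?_, fin := ?_, Δ := Δ
      gr := IsGr.of_gens S hS (by rintro _ ⟨n, i, x, hx, rfl⟩; exact ⟨_, hΔ n i x hx⟩)
      smul := ?_, dΔ := ?_, finH := ?_, nz := ?_ } σ ?_ ?_ ?_ ?_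
  · refine hLext (f := d.comp d) (g := 0) fun n x => ?_
    change d (d (L n x)) = 0
    rw [hdL0, hdL0, F.dd, map_zero]
  · exact Module.Projective.directSum
  · refine ⟨?_⟩
    have : (⊤ : Submodule A T) = ⨆ n ∈ I, LinearMap.range (L n) := by
      rw [eq_comm, eq_top_iff]
      rintro t -
      rw [hsum t]
      refine Submodule.sum_mem _ fun n hn => ?_
      exact Submodule.mem_iSup_of_mem n (Submodule.mem_iSup_of_mem hn ⟨_, rfl⟩)
    rw [this]
    refine Submodule.fg_biSup _ _ fun n _ => ?_
    rw [LinearMap.range_eq_map]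
    exact (hfin n).fg_top.map _
  · intro i e a t ha ht
    refine IsGr.deg_of_gens (δ := Δ.toAddMonoidHom) (δ' := Δ.toAddMonoidHom)
      (DistribSMul.toAddMonoidHom T a) (fun e => (i + e.1, e.2)) S hS ?_ e t ht
    rintro _ ⟨n, j, x, hx, rfl⟩
    refine ⟨_, hΔ n j x hx, ?_⟩
    have h1 : a • L n x = L n (a • x) := (map_smul _ _ _).symm
    change Δ (a • L n x) = single _ (a • L n x)
    rw [h1]
    exact hΔ n _ _ (F.smul n i j a x ha hx)
  · intro e t ht
    refine IsGr.deg_of_gens (δ := Δ.toAddMonoidHom) (δ' := Δ.toAddMonoidHom)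
      d.toAddMonoidHom (fun e => (e.1, e.2 + 1)) S hS ?_ e t ht
    rintro _ ⟨n, j, x, hx, rfl⟩
    refine ⟨_, hΔ n j x hx, ?_⟩
    change Δ (d (L n x)) = single _ (d (L n x))
    rw [hdL0]
    exact hΔ _ _ _ (F.dδ n (n + 1) j x hx)
  · have h1 := fun n : ℤ => (F.finH (n - 1) n (n + 1) (by omega) rfl).sub
    choose V hV hVz using h1
    refine FinH.of_sub (⨆ n ∈ I, (V n).map ((L n).restrictScalars k))
      (Submodule.fg_biSup _ _ fun n _ => (hV n).map _) fun z hz => ?_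
    have h2 : ∀ n, ∃ v ∈ V n, ∃ y, p n z = v + F.d (n - 1) n y := fun n =>
      hVz n _ (by rw [← hpd n (n + 1) rfl, hz, map_zero])
    choose v hv y hy using h2
    refine ⟨∑ n ∈ I, L n (v n), Submodule.sum_mem _ fun n hn => ?_,
      ∑ n ∈ I, L (n - 1) (y n), ?_⟩
    · exact Submodule.mem_iSup_of_mem n (Submodule.mem_iSup_of_mem hn ⟨_, hv n, rfl⟩)
    · rw [map_sum, ← Finset.sum_add_distrib]
      conv_lhs => rw [hsum z]
      refine Finset.sum_congr rfl fun n _ => ?_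
      rw [hy, map_add, hdL (n - 1) n (by omega)]
  · obtain ⟨i, j, l, hij, hjl, z, hz, hy⟩ := F.nz
    refine ⟨L j z, ?_, fun y h => hy (p i y) ?_⟩
    · rw [hdL j l hjl, hz, map_zero]
    · rw [← hpd i j hij, h, hpL]
  · refine hLext (f := σ.comp σ) (g := LinearMap.id) fun n x => ?_
    change σ (σ (L n x)) = L n x
    rw [hσL, map_zsmul, hσL, smul_smul, hss, one_smul]
  · refine hLext (f := σ.comp d) (g := -(d.comp σ)) fun n x => ?_
    change σ (d (L n x)) = -d (σ (L n x))
    rw [hdL0, hσL, hσL, map_zsmul, hdL0, hs1, neg_smul]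
  · intro e t ht
    refine IsGr.deg_of_gens (δ := Δ.toAddMonoidHom) (δ' := Δ.toAddMonoidHom)
      σ.toAddMonoidHom (fun e => e) S hS ?_ e t ht
    rintro _ ⟨n, j, x, hx, rfl⟩
    refine ⟨_, hΔ n j x hx, ?_⟩
    change Δ (σ (L n x)) = single _ (σ (L n x))
    rw [hσL, map_zsmul, hΔ n j x hx, Finsupp.smul_single]
  · intro h2
    refine hLext (f := σ) (g := LinearMap.id) fun n x => ?_
    change σ (L n x) = L n x
    rw [hσL]
    simp only [s]
    split_ifs with h
    · rw [one_smul]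
    · have h3 : (2 : k) • L n x = 0 := by rw [h2, zero_smul]
      rw [two_smul] at h3
      rw [neg_smul, one_smul]
      exact neg_eq_of_add_eq_zero_left h3

end EpsAux

namespace EpsAux
open Finsupp TensorProduct

theorem exists_ginv {k T : Type} [Field k] [AddCommGroup T] [Module k T] (d : Module.End k T) :
    ∃ h : Module.End k T, d * h * d = d := by
  obtain ⟨g, hg⟩ := LinearMap.exists_rightInverse_of_surjective d.rangeRestrict
    (LinearMap.range_rangeRestrict d)
  obtain ⟨r, hr⟩ := LinearMap.exists_leftInverse_of_injective (LinearMap.range d).subtype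
    (Submodule.ker_subtype _)
  refine ⟨g ∘ₗ r, LinearMap.ext fun x => ?_⟩
  have h1 : r (d x) = d.rangeRestrict x := LinearMap.congr_fun hr (d.rangeRestrict x)
  have h2 : d.rangeRestrict (g (d.rangeRestrict x)) = d.rangeRestrict x :=
    LinearMap.congr_fun hg (d.rangeRestrict x)
  change d (g (r (d x))) = d x
  rw [h1]
  exact congrArg Subtype.val h2

theorem exists_htpy {k T : Type} [Field k] [AddCommGroup T] [Module k T] (d σ : Module.End k T)
    (hσ : σ * σ = 1) (hσd : σ * d = - (d * σ)) (h2 : (2 : k) = 0 → σ = 1) :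
    ∃ h : Module.End k T, d * h * d = d ∧ h * σ = - (σ * h) := by
  obtain ⟨h, hh⟩ := exists_ginv d
  by_cases hk : (2 : k) = 0
  · refine ⟨h, hh, ?_⟩
    rw [h2 hk, mul_one, one_mul, eq_neg_iff_add_eq_zero, ← two_smul k, hk, zero_smul]
  · refine ⟨(2 : k)⁻¹ • (h - σ * h * σ), ?_, ?_⟩
    · have h3 : d * (σ * h * σ) * d = -d := by
        have h5 : d * σ = - (σ * d) := by rw [hσd, neg_neg]
        have h6 : d * (σ * h * σ) * d = σ * (d * h * d) * σ := calc
          d * (σ * h * σ) * d = (d * σ) * h * (σ * d) := by noncomm_ring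
          _ = -(σ * d) * h * -(d * σ) := by rw [← h5, ← hσd]
          _ = _ := by noncomm_ring
        rw [h6, hh, hσd, neg_mul, mul_assoc, hσ, mul_one]
      rw [mul_smul_comm, smul_mul_assoc, mul_sub, sub_mul, hh, h3, sub_neg_eq_add, ← two_smul k,
        smul_smul, inv_mul_cancel₀ hk, one_smul]
    · rw [smul_mul_assoc, mul_smul_comm, ← smul_neg, sub_mul, mul_sub, mul_assoc _ σ σ, hσ,
        mul_one, ← mul_assoc, ← mul_assoc, hσ, one_mul, neg_sub]

/-- The homotopy identities of the Künneth formula, in an abstract ring. -/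
theorem ring_htpy {R : Type} [Ring R] {D₁ D₂ S H₁ H₂ : R} (hD₁ : D₁ * D₁ = 0)
    (hD₂ : D₂ * D₂ = 0) (cDD : Commute D₁ D₂) (hS : S * S = 1) (hSD : S * D₁ = - (D₁ * S)) (hHS : H₁ * S = - (S * H₁))
    (cHD : Commute H₁ D₂) (cSD : Commute S D₂) (cSH : Commute S H₂) (cDH : Commute D₁ H₂) :
    (D₁ + S * D₂) * H₁ + H₁ * (D₁ + S * D₂) = D₁ * H₁ + H₁ * D₁ ∧
    (D₁ + S * D₂) * (S * H₂) + S * H₂ * (D₁ + S * D₂) = D₂ * H₂ + H₂ * D₂ ∧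
    (D₁ + S * D₂) * (D₁ + S * D₂) = 0 := by
  refine ⟨?_, ?_, ?_⟩
  · have h1 : S * D₂ * H₁ = S * H₁ * D₂ := by rw [mul_assoc, ← cHD.eq, mul_assoc]
    have h2 : H₁ * (S * D₂) = - (S * H₁ * D₂) := by rw [← mul_assoc, hHS, neg_mul]
    rw [add_mul, mul_add, h1, h2]
    abel
  · have h1 : S * D₂ * (S * H₂) = D₂ * H₂ := by
      rw [cSD.eq, mul_assoc, ← mul_assoc S S, hS, one_mul]
    have h2 : S * H₂ * (S * D₂) = H₂ * D₂ := by
      rw [cSH.eq, mul_assoc, ← mul_assoc S S, hS, one_mul]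
    have h3 : S * H₂ * D₁ = - (D₁ * (S * H₂)) := by
      rw [mul_assoc, ← cDH.eq, ← mul_assoc, hSD, neg_mul, mul_assoc]
    rw [add_mul, mul_add, h1, h2, h3]
    abel
  · have h1 : S * D₂ * (S * D₂) = 0 := by
      rw [mul_assoc, cSD.eq, ← mul_assoc D₂ D₂, hD₂, zero_mul, mul_zero]
    have h3 : S * D₂ * D₁ = - (D₁ * (S * D₂)) := by
      rw [mul_assoc, ← cDD.eq, ← mul_assoc, hSD, neg_mul, mul_assoc]
    rw [add_mul, mul_add, mul_add, h1, h3, hD₁]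
    abel

theorem tmul_ne_zero' {k M N : Type} [Field k] [AddCommGroup M] [Module k M] [AddCommGroup N]
    [Module k N] {m : M} {n : N} (hm : m ≠ 0) (hn : n ≠ 0) : m ⊗ₜ[k] n ≠ 0 := by
  intro h
  have h1 : ∃ f : Module.Dual k M, f m ≠ 0 := by
    by_contra hc
    push Not at hc
    exact hm ((Module.forall_dual_apply_eq_zero_iff k m).1 hc)
  have h2 : ∃ f : Module.Dual k N, f n ≠ 0 := by
    by_contra hc
    push Not at hc
    exact hn ((Module.forall_dual_apply_eq_zero_iff k n).1 hc)
  obtain ⟨f, hf⟩ := h1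
  obtain ⟨g, hg⟩ := h2
  have h3 := congrArg (fun x => TensorProduct.lid k k (TensorProduct.map f g x)) h
  simp [hf, hg] at h3

/-- Künneth. -/
theorem kunneth {k M N : Type} [Field k] [AddCommGroup M] [Module k M] [AddCommGroup N]
    [Module k N] (d σ : Module.End k M) (d' : Module.End k N)
    (hd : d * d = 0) (hd' : d' * d' = 0)
    (hσ : σ * σ = 1) (hσd : σ * d = - (d * σ)) (h2 : (2 : k) = 0 → σ = 1)
    (V : Submodule k M) (hV : V.FG) (hVz : ∀ z, d z = 0 → ∃ v ∈ V, ∃ y, z = v + d y)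
    (W : Submodule k N) (hW : W.FG) (hWz : ∀ z, d' z = 0 → ∃ v ∈ W, ∃ y, z = v + d' y)
    (hM : ∃ z, d z = 0 ∧ ∀ y, d y ≠ z) (hN : ∃ z, d' z = 0 ∧ ∀ y, d' y ≠ z)
    (D : Module.End k (M ⊗[k] N)) (hD : D = TensorProduct.map d 1 + TensorProduct.map σ d') :
    (∀ z, D (D z) = 0) ∧
    (∃ U : Submodule k (M ⊗[k] N), U.FG ∧ ∀ z, D z = 0 → ∃ v ∈ U, ∃ y, z = v + D y) ∧
    (∃ z, D z = 0 ∧ ∀ y, D y ≠ z) := by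
  obtain ⟨h, hh, hhσ⟩ := exists_htpy d σ hσ hσd h2
  obtain ⟨h', hh'⟩ := exists_ginv d'
  let p : Module.End k M := 1 - d * h - h * d
  let q : Module.End k N := 1 - d' * h' - h' * d'
  have hdp : d * p = 0 := by
    simp only [p, mul_sub, mul_one, ← mul_assoc, hd, hh, zero_mul, sub_zero, sub_self]
  have hpd : p * d = 0 := by
    simp only [p, sub_mul, one_mul, mul_assoc h, hd, hh, mul_zero, sub_zero, sub_self]
  have hdq : d' * q = 0 := by
    simp only [q, mul_sub, mul_one, ← mul_assoc, hd', hh', zero_mul, sub_zero, sub_self]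
  have hqd : q * d' = 0 := by
    simp only [q, sub_mul, one_mul, mul_assoc h', hd', hh', mul_zero, sub_zero, sub_self]
  let L : Module.End k M → Module.End k (M ⊗[k] N) := fun f => TensorProduct.map f 1
  let R : Module.End k N → Module.End k (M ⊗[k] N) := fun f => TensorProduct.map 1 f
  have hLm : ∀ f g, L (f * g) = L f * L g := fun f g => by
    change TensorProduct.map _ _ = TensorProduct.map _ _ * TensorProduct.map _ _
    rw [← TensorProduct.map_mul, one_mul]
  have hRm : ∀ f g, R (f * g) = R f * R g := fun f g => by
    change TensorProduct.map _ _ = TensorProduct.map _ _ * TensorProduct.map _ _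
    rw [← TensorProduct.map_mul, one_mul]
  have hLR : ∀ f g, L f * R g = TensorProduct.map f g := fun f g => by
    change TensorProduct.map _ _ * TensorProduct.map _ _ = _
    rw [← TensorProduct.map_mul, one_mul, mul_one]
  have hRL : ∀ f g, R g * L f = TensorProduct.map f g := fun f g => by
    change TensorProduct.map _ _ * TensorProduct.map _ _ = _
    rw [← TensorProduct.map_mul, one_mul, mul_one]
  have hc : ∀ f g, Commute (L f) (R g) := fun f g => (hLR f g).trans (hRL f g).symm
  have hL1 : L 1 = 1 := TensorProduct.map_one
  have hR1 : R 1 = 1 := TensorProduct.map_one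
  have hLa : ∀ f g, L (f + g) = L f + L g := fun f g => TensorProduct.map_add_left f g 1
  have hRa : ∀ f g, R (f + g) = R f + R g := fun f g => TensorProduct.map_add_right 1 f g
  have hLs : ∀ f g, L (f - g) = L f - L g := fun f g => by
    rw [eq_sub_iff_add_eq, ← hLa, sub_add_cancel]
  have hRs : ∀ f g, R (f - g) = R f - R g := fun f g => by
    rw [eq_sub_iff_add_eq, ← hRa, sub_add_cancel]
  have hL0 : L 0 = 0 := TensorProduct.map_zero_left _
  have hR0 : R 0 = 0 := TensorProduct.map_zero_right _
  have hLn : ∀ f, L (-f) = - L f := fun f => by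
    rw [eq_neg_iff_add_eq_zero, ← hLa, neg_add_cancel, hL0]
  have hD' : D = L d + L σ * R d' := by rw [hD, hLR]
  obtain ⟨e1, e2, hDD⟩ := ring_htpy (D₁ := L d) (D₂ := R d') (S := L σ) (H₁ := L h) (H₂ := R h')
    (by rw [← hLm, hd, hL0]) (by rw [← hRm, hd', hR0]) (hc _ _)
    (by rw [← hLm, hσ, hL1]) (by rw [← hLm, hσd, hLn, hLm]) (by rw [← hLm, hhσ, hLn, hLm])
    (hc _ _) (hc _ _) (hc _ _) (hc _ _)
  rw [← hD'] at e1 e2 hDD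
  have hDD' : ∀ z, D (D z) = 0 := fun z => LinearMap.congr_fun hDD z
  have e1' : ∀ z, D z = 0 → z = L p z + D (L h z) := by
    intro z hz
    have h3 : L p = 1 - (D * L h + L h * D) := by
      rw [e1]
      simp only [p, hLs, hL1, hLm]
      abel
    have h4 : L p z = z - (D (L h z) + L h (D z)) := LinearMap.congr_fun h3 z
    rw [h4, hz, map_zero]
    abel
  have e2' : ∀ z, D z = 0 → z = R q z + D ((L σ * R h') z) := by
    intro z hz
    have h3 : R q = 1 - (D * (L σ * R h') + L σ * R h' * D) := by
      rw [e2]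
      simp only [q, hRs, hR1, hRm]
      abel
    have h4 : R q z = z - (D ((L σ * R h') z) + (L σ * R h') (D z)) := LinearMap.congr_fun h3 z
    rw [h4, hz, map_zero]
    abel
  have e3 : ∀ z, D z = 0 → ∃ y, z = TensorProduct.map p q z + D y := by
    intro z hz
    have h1 := e1' z hz
    have h3 : D (L p z) = 0 := by
      have := congrArg D h1
      rw [map_add, hDD', hz, add_zero] at this
      exact this.symm
    have h4 := e2' _ h3
    refine ⟨(L σ * R h') (L p z) + L h z, ?_⟩
    rw [map_add, ← add_assoc, ← hRL]
    conv_lhs => rw [h1, h4]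
    rfl
  have e4 : ∀ z, D z = 0 → ∃ y, z = TensorProduct.map (p * p) (q * q) z + D y := by
    intro z hz
    obtain ⟨y, hy⟩ := e3 z hz
    have h3 : D (TensorProduct.map p q z) = 0 := by
      have := congrArg D hy
      rw [map_add, hDD', hz, add_zero] at this
      exact this.symm
    obtain ⟨y', hy'⟩ := e3 _ h3
    refine ⟨y' + y, ?_⟩
    rw [TensorProduct.map_mul, map_add, ← add_assoc]
    conv_lhs => rw [hy, hy']
    rfl
  have hp' : ∀ x, (p * p) x ∈ V.map p := by
    intro x
    obtain ⟨v, hv, y, hy⟩ := hVz (p x) (LinearMap.congr_fun hdp x)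
    have : (p * p) x = p v := by
      change p (p x) = p v
      rw [hy, map_add]
      have : p (d y) = 0 := LinearMap.congr_fun hpd y
      rw [this, add_zero]
    rw [this]
    exact ⟨v, hv, rfl⟩
  have hq' : ∀ x, (q * q) x ∈ W.map q := by
    intro x
    obtain ⟨v, hv, y, hy⟩ := hWz (q x) (LinearMap.congr_fun hdq x)
    have : (q * q) x = q v := by
      change q (q x) = q v
      rw [hy, map_add]
      have : q (d' y) = 0 := LinearMap.congr_fun hqd y
      rw [this, add_zero]
    rw [this]
    exact ⟨v, hv, rfl⟩
  refine ⟨hDD', ⟨Submodule.map₂ (TensorProduct.mk k M N) (V.map p) (W.map q),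
    (hV.map p).map₂ _ (hW.map q), fun z hz => ?_⟩, ?_⟩
  · obtain ⟨y, hy⟩ := e4 z hz
    refine ⟨_, ?_, y, hy⟩
    clear hy hz
    induction z using TensorProduct.induction_on with
    | zero => rw [map_zero]; exact zero_mem _
    | tmul a b =>
      rw [TensorProduct.map_tmul]
      exact Submodule.apply_mem_map₂ _ (hp' a) (hq' b)
    | add a b ha hb => rw [map_add]; exact add_mem ha hb
  · obtain ⟨w, hw, hw'⟩ := hM
    obtain ⟨v, hv, hv'⟩ := hN
    have hpp : p (p w) = p w := by
      have h1 : p w = w - d (h w) - h (d w) := rfl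
      have h3 : p (d (h w)) = 0 := LinearMap.congr_fun hpd _
      conv_lhs => rw [h1, hw, map_zero, sub_zero, map_sub, h3, sub_zero]
    have hqq : q (q v) = q v := by
      have h1 : q v = v - d' (h' v) - h' (d' v) := rfl
      have h3 : q (d' (h' v)) = 0 := LinearMap.congr_fun hqd _
      conv_lhs => rw [h1, hv, map_zero, sub_zero, map_sub, h3, sub_zero]
    have hp0 : p w ≠ 0 := by
      intro h0
      have h1 : p w = w - d (h w) - h (d w) := rfl
      rw [h0, hw, map_zero, sub_zero] at h1
      exact hw' _ (sub_eq_zero.1 h1.symm).symm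
    have hq0 : q v ≠ 0 := by
      intro h0
      have h1 : q v = v - d' (h' v) - h' (d' v) := rfl
      rw [h0, hv, map_zero, sub_zero] at h1
      exact hv' _ (sub_eq_zero.1 h1.symm).symm
    refine ⟨p w ⊗ₜ[k] q v, ?_, fun y hy => ?_⟩
    · have h1 : d (p w) = 0 := LinearMap.congr_fun hdp w
      have h3 : d' (q v) = 0 := LinearMap.congr_fun hdq v
      rw [hD, LinearMap.add_apply, TensorProduct.map_tmul, TensorProduct.map_tmul, h1, h3,
        zero_tmul, tmul_zero, add_zero]
    · have h1 : TensorProduct.map p q * D = 0 := by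
        rw [hD, mul_add, ← TensorProduct.map_mul, ← TensorProduct.map_mul, hpd, hqd,
          TensorProduct.map_zero_left, TensorProduct.map_zero_right, add_zero]
      have h3 : TensorProduct.map p q (D y) = 0 := LinearMap.congr_fun h1 y
      rw [hy, TensorProduct.map_tmul, hpp, hqq] at h3
      exact tmul_ne_zero' hp0 hq0 h3

end EpsAux

namespace EpsAux
open Finsupp TensorProduct

section
variable {k : Type} [Field k] {A B : Type} [Ring A] [Algebra k A] [Ring B] [Algebra k B]

theorem tmap_smul {M N M' N' : Type}
    [AddCommGroup M] [Module k M] [Module A M] [IsScalarTower k A M]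
    [AddCommGroup N] [Module k N] [Module B N] [IsScalarTower k B N]
    [AddCommGroup M'] [Module k M'] [Module A M'] [IsScalarTower k A M']
    [AddCommGroup N'] [Module k N'] [Module B N'] [IsScalarTower k B N']
    [Module (A ⊗[k] B) (M ⊗[k] N)] [Module (A ⊗[k] B) (M' ⊗[k] N')]
    (hs : ∀ (a : A) (b : B) (m : M) (n : N),
      (a ⊗ₜ[k] b) • (m ⊗ₜ[k] n) = (a • m) ⊗ₜ[k] (b • n))
    (hs' : ∀ (a : A) (b : B) (m : M') (n : N'),
      (a ⊗ₜ[k] b) • (m ⊗ₜ[k] n) = (a • m) ⊗ₜ[k] (b • n))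
    (f : M →ₗ[A] M') (g : N →ₗ[B] N') (r : A ⊗[k] B) (t : M ⊗[k] N) :
    TensorProduct.map (f.restrictScalars k) (g.restrictScalars k) (r • t) =
      r • TensorProduct.map (f.restrictScalars k) (g.restrictScalars k) t := by
  induction r using TensorProduct.induction_on with
  | zero => rw [zero_smul, zero_smul, map_zero]
  | add r r' hr hr' => rw [add_smul, add_smul, map_add, hr, hr']
  | tmul a b =>
    induction t using TensorProduct.induction_on with
    | zero => rw [smul_zero, map_zero, smul_zero]
    | add t t' ht ht' => rw [smul_add, map_add, map_add, smul_add, ht, ht']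
    | tmul m n =>
      rw [hs, TensorProduct.map_tmul, TensorProduct.map_tmul, hs']
      simp

theorem tensor_split {M N : Type}
    [AddCommGroup M] [Module k M] [Module A M] [IsScalarTower k A M]
    [AddCommGroup N] [Module k N] [Module B N] [IsScalarTower k B N]
    [Module (A ⊗[k] B) (M ⊗[k] N)]
    (hs : ∀ (a : A) (b : B) (m : M) (n : N),
      (a ⊗ₜ[k] b) • (m ⊗ₜ[k] n) = (a • m) ⊗ₜ[k] (b • n))
    [Module.Finite A M] [Module.Projective A M] [Module.Finite B N] [Module.Projective B N] :
    Module.Projective (A ⊗[k] B) (M ⊗[k] N) ∧ Module.Finite (A ⊗[k] B) (M ⊗[k] N) := by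
  classical
  obtain ⟨m, f, g, -, -, hfg⟩ := Module.Finite.exists_comp_eq_id_of_projective A M
  obtain ⟨n, f', g', -, -, hfg'⟩ := Module.Finite.exists_comp_eq_id_of_projective B N
  let e : (M ⊗[k] N) →ₗ[A ⊗[k] B] (Fin m × Fin n → A ⊗[k] B) := LinearMap.pi fun pq =>
    { TensorProduct.map (((LinearMap.proj pq.1).comp g).restrictScalars k)
        (((LinearMap.proj pq.2).comp g').restrictScalars k) with
      map_smul' := tmap_smul hs (fun a b x y => Algebra.TensorProduct.tmul_mul_tmul a x b y)
        ((LinearMap.proj pq.1).comp g) ((LinearMap.proj pq.2).comp g') }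
  let x : Fin m → M := fun p => f (Pi.single p 1)
  let y : Fin n → N := fun q => f' (Pi.single q 1)
  let r : (Fin m × Fin n → A ⊗[k] B) →ₗ[A ⊗[k] B] (M ⊗[k] N) :=
    Fintype.linearCombination (A ⊗[k] B) (fun pq : Fin m × Fin n => x pq.1 ⊗ₜ[k] y pq.2)
  have hx : ∀ u : M, u = ∑ p, g u p • x p := fun u => by
    have h1 : f (g u) = u := LinearMap.congr_fun hfg u
    conv_lhs => rw [← h1, LinearMap.pi_apply_eq_sum_univ f (g u)]
    refine Finset.sum_congr rfl fun p _ => ?_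
    congr 2
    ext j
    simp [Pi.single_apply, eq_comm]
  have hy : ∀ u : N, u = ∑ p, g' u p • y p := fun u => by
    have h1 : f' (g' u) = u := LinearMap.congr_fun hfg' u
    conv_lhs => rw [← h1, LinearMap.pi_apply_eq_sum_univ f' (g' u)]
    refine Finset.sum_congr rfl fun p _ => ?_
    congr 2
    ext j
    simp [Pi.single_apply, eq_comm]
  have hre : ∀ t, r (e t) = t := by
    intro t
    induction t using TensorProduct.induction_on with
    | zero => rw [map_zero, map_zero]
    | add t t' ht ht' => rw [map_add, map_add, ht, ht']
    | tmul u v =>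
      have h1 : r (e (u ⊗ₜ[k] v)) = ∑ pq : Fin m × Fin n,
          (g u pq.1 ⊗ₜ[k] g' v pq.2) • (x pq.1 ⊗ₜ[k] y pq.2) := rfl
      rw [h1]
      conv_rhs => rw [hx u, hy v]
      simp only [hs, TensorProduct.sum_tmul, TensorProduct.tmul_sum]
      rw [Fintype.sum_prod_type, Finset.sum_comm]
  exact ⟨Module.Projective.of_split e r (LinearMap.ext hre),
    Module.Finite.of_surjective r (fun t => ⟨e t, hre t⟩)⟩

theorem Tot.tensor {𝒜 : ℤ → Submodule k A} {ℬ : ℤ → Submodule k B} {M N : Type}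
    [AddCommGroup M] [Module k M] [Module A M] [IsScalarTower k A M]
    [AddCommGroup N] [Module k N] [Module B N] [IsScalarTower k B N]
    [Module (A ⊗[k] B) (M ⊗[k] N)] [IsScalarTower k (A ⊗[k] B) (M ⊗[k] N)]
    (hs : ∀ (a : A) (b : B) (m : M) (n : N),
      (a ⊗ₜ[k] b) • (m ⊗ₜ[k] n) = (a • m) ⊗ₜ[k] (b • n))
    (hA : AddSubgroup.closure {a : A | ∃ i, a ∈ 𝒜 i} = ⊤)
    (hB : AddSubgroup.closure {b : B | ∃ i, b ∈ ℬ i} = ⊤)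
    (G : Tot k A 𝒜 M) (σ : M →ₗ[A] M) (hσ : ∀ x, σ (σ x) = x)
    (hσd : ∀ x, σ (G.d x) = - G.d (σ x))
    (hσΔ : ∀ e t, G.Δ t = single e t → G.Δ (σ t) = single e (σ t))
    (h2 : (2 : k) = 0 → ∀ x, σ x = x) (G' : Tot k B ℬ N) :
    EpsCondition k (A ⊗[k] B) (fun p : ℤ × ℤ => Submodule.span k
          {x : A ⊗[k] B | ∃ a ∈ 𝒜 p.1, ∃ b ∈ ℬ p.2, x = a ⊗ₜ[k] b}) := by
  have hf1 := G.fin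
  have hf2 := G.proj
  have hf3 := G'.fin
  have hf4 := G'.proj
  obtain ⟨V, hV, hVz⟩ := G.finH.sub
  obtain ⟨W, hW, hWz⟩ := G'.finH.sub
  let d : Module.End k M := G.d.restrictScalars k
  let d' : Module.End k N := G'.d.restrictScalars k
  let s : Module.End k M := σ.restrictScalars k
  obtain ⟨hDD, ⟨U, hU, hUz⟩, hnz⟩ := kunneth d s d' (LinearMap.ext G.dd) (LinearMap.ext G'.dd)
    (LinearMap.ext hσ) (LinearMap.ext hσd) (fun h => LinearMap.ext (h2 h)) V hV hVz W hW hWz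
    G.nz G'.nz (TensorProduct.map d 1 + TensorProduct.map s d') rfl
  let D : (M ⊗[k] N) →ₗ[A ⊗[k] B] (M ⊗[k] N) :=
    { TensorProduct.map d (1 : Module.End k N) + TensorProduct.map s d' with
      map_smul' := fun r t => by
        have h1 := tmap_smul hs hs G.d (LinearMap.id : N →ₗ[B] N) r t
        have h3 := tmap_smul hs hs σ G'.d r t
        change TensorProduct.map d 1 (r • t) + TensorProduct.map s d' (r • t) =
          r • (TensorProduct.map d 1 t + TensorProduct.map s d' t)
        rw [smul_add]
        exact congrArg₂ (· + ·) h1 h3 }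
  have hDt : ∀ m n, D (m ⊗ₜ[k] n) = G.d m ⊗ₜ[k] n + σ m ⊗ₜ[k] G'.d n := fun m n => rfl
  let φ : (ℤ × ℤ) × (ℤ × ℤ) → (ℤ × ℤ) × ℤ := fun e => ((e.1.1, e.2.1), e.1.2 + e.2.2)
  let Δ : (M ⊗[k] N) →ₗ[k] ((ℤ × ℤ) × ℤ →₀ (M ⊗[k] N)) :=
    (Finsupp.lmapDomain (M ⊗[k] N) k φ).comp
      ((finsuppTensorFinsupp k k M N (ℤ × ℤ) (ℤ × ℤ)).toLinearMap.comp
        (TensorProduct.map G.Δ G'.Δ))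
  have hΔ : ∀ e e' m n, G.Δ m = single e m → G'.Δ n = single e' n →
      Δ (m ⊗ₜ[k] n) = single ((e.1, e'.1), e.2 + e'.2) (m ⊗ₜ[k] n) := by
    intro e e' m n hm hn
    have h1 : Δ (m ⊗ₜ[k] n) = Finsupp.mapDomain φ
      (finsuppTensorFinsupp k k M N (ℤ × ℤ) (ℤ × ℤ) (G.Δ m ⊗ₜ[k] G'.Δ n)) := rfl
    rw [h1, hm, hn, finsuppTensorFinsupp_single, Finsupp.mapDomain_single]
  let S : Set (M ⊗[k] N) := {t | ∃ e e' m n, G.Δ m = single e m ∧ G'.Δ n = single e' n ∧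
    t = m ⊗ₜ[k] n}
  have hS : AddSubgroup.closure S = ⊤ := by
    rw [eq_top_iff]
    rintro t -
    induction t using TensorProduct.induction_on with
    | zero => exact zero_mem _
    | add t t' ht ht' => exact add_mem ht ht'
    | tmul m n =>
      have hm : m ∈ AddSubgroup.closure {m | ∃ i, G.Δ.toAddMonoidHom m = single i m} := by
        rw [G.gr.closure]; trivial
      have hn : n ∈ AddSubgroup.closure {m | ∃ i, G'.Δ.toAddMonoidHom m = single i m} := by
        rw [G'.gr.closure]; trivial
      induction hm using AddSubgroup.closure_induction with
      | zero => rw [zero_tmul]; exact zero_mem _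
      | add x y _ _ hx hy => rw [add_tmul]; exact add_mem hx hy
      | neg x _ hx => rw [neg_tmul]; exact neg_mem hx
      | mem m hm =>
        induction hn using AddSubgroup.closure_induction with
        | zero => rw [tmul_zero]; exact zero_mem _
        | add x y _ _ hx hy => rw [tmul_add]; exact add_mem hx hy
        | neg x _ hx => rw [tmul_neg]; exact neg_mem hx
        | mem n hn =>
          obtain ⟨e, he⟩ := hm
          obtain ⟨e', he'⟩ := hn
          exact AddSubgroup.subset_closure ⟨e, e', m, n, he, he', rfl⟩
  refine Tot.eps (T := M ⊗[k] N) ?_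
    { d := D, dd := hDD, proj := (tensor_split hs).1, fin := (tensor_split hs).2, Δ := Δ
      gr := IsGr.of_gens S hS (by
        rintro _ ⟨e, e', m, n, hm, hn, rfl⟩; exact ⟨_, hΔ e e' m n hm hn⟩)
      smul := ?_, dΔ := ?_, finH := FinH.of_sub U hU hUz, nz := hnz }
  · rw [eq_top_iff]
    rintro t -
    induction t using TensorProduct.induction_on with
    | zero => exact zero_mem _
    | add t t' ht ht' => exact add_mem ht ht'
    | tmul a b =>
      have ha : a ∈ AddSubgroup.closure {a : A | ∃ i, a ∈ 𝒜 i} := by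
        rw [hA]; trivial
      have hb : b ∈ AddSubgroup.closure {b : B | ∃ i, b ∈ ℬ i} := by
        rw [hB]; trivial
      induction ha using AddSubgroup.closure_induction with
      | zero => rw [zero_tmul]; exact zero_mem _
      | add x y _ _ hx hy => rw [add_tmul]; exact add_mem hx hy
      | neg x _ hx => rw [neg_tmul]; exact neg_mem hx
      | mem a ha =>
        induction hb using AddSubgroup.closure_induction with
        | zero => rw [tmul_zero]; exact zero_mem _
        | add x y _ _ hx hy => rw [tmul_add]; exact add_mem hx hy
        | neg x _ hx => rw [tmul_neg]; exact neg_mem hx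
        | mem b hb =>
          obtain ⟨i, hi⟩ := ha
          obtain ⟨j, hj⟩ := hb
          exact AddSubgroup.subset_closure
            ⟨(i, j), Submodule.subset_span ⟨a, hi, b, hj, rfl⟩⟩
  · intro i e a t ha ht
    refine smul_span Δ _ t (i + e.1, e.2) ?_ a ha
    rintro _ ⟨a, ha, b, hb, rfl⟩
    refine IsGr.deg_of_gens (δ := Δ.toAddMonoidHom) (δ' := Δ.toAddMonoidHom)
      (DistribSMul.toAddMonoidHom (M ⊗[k] N) (a ⊗ₜ[k] b)) (fun e => (i + e.1, e.2)) S hS ?_ e t ht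
    rintro _ ⟨e, e', m, n, hm, hn, rfl⟩
    refine ⟨_, hΔ e e' m n hm hn, ?_⟩
    change Δ ((a ⊗ₜ[k] b) • (m ⊗ₜ[k] n)) = single _ ((a ⊗ₜ[k] b) • (m ⊗ₜ[k] n))
    rw [hs]
    exact hΔ _ _ _ _ (G.smul _ _ _ _ ha hm) (G'.smul _ _ _ _ hb hn)
  · intro e t ht
    refine IsGr.deg_of_gens (δ := Δ.toAddMonoidHom) (δ' := Δ.toAddMonoidHom)
      D.toAddMonoidHom (fun e => (e.1, e.2 + 1)) S hS ?_ e t ht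
    rintro _ ⟨e, e', m, n, hm, hn, rfl⟩
    refine ⟨_, hΔ e e' m n hm hn, ?_⟩
    change Δ (D (m ⊗ₜ[k] n)) = single _ (D (m ⊗ₜ[k] n))
    rw [hDt, map_add, hΔ _ _ _ _ (G.dΔ _ _ hm) hn, hΔ _ _ _ _ (hσΔ _ _ hm) (G'.dΔ _ _ hn)]
    have h5 : e.2 + 1 + e'.2 = e.2 + e'.2 + 1 := by ring
    have h6 : e.2 + (e'.2 + 1) = e.2 + e'.2 + 1 := by ring
    dsimp only
    rw [h5, h6, ← Finsupp.single_add]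

theorem three_one (𝒜 : ℤ → Submodule k A) [GradedAlgebra 𝒜]
    (ℬ : ℤ → Submodule k B) [GradedAlgebra ℬ]
    (hA : EpsCondition k A 𝒜) (hB : EpsCondition k B ℬ) :
    EpsCondition k (A ⊗[k] B) (fun p : ℤ × ℤ => Submodule.span k
          {x : A ⊗[k] B | ∃ a ∈ 𝒜 p.1, ∃ b ∈ ℬ p.2, x = a ⊗ₜ[k] b}) := by
  have hA0 : ∀ c : k, algebraMap k A c ∈ 𝒜 0 := fun c => by
    rw [Algebra.algebraMap_eq_smul_one]
    exact Submodule.smul_mem _ _ SetLike.GradedOne.one_mem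
  have hB0 : ∀ c : k, algebraMap k B c ∈ ℬ 0 := fun c => by
    rw [Algebra.algebraMap_eq_smul_one]
    exact Submodule.smul_mem _ _ SetLike.GradedOne.one_mem
  have hAc : AddSubgroup.closure {a : A | ∃ i, a ∈ 𝒜 i} = ⊤ := by
    rw [eq_top_iff]
    rintro t -
    induction t using DirectSum.Decomposition.inductionOn 𝒜 with
    | zero => exact zero_mem _
    | homogeneous m => exact AddSubgroup.subset_closure ⟨_, m.2⟩
    | add _ _ h h' => exact add_mem h h'
  have hBc : AddSubgroup.closure {a : B | ∃ i, a ∈ ℬ i} = ⊤ := by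
    rw [eq_top_iff]
    rintro t -
    induction t using DirectSum.Decomposition.inductionOn ℬ with
    | zero => exact zero_mem _
    | homogeneous m => exact AddSubgroup.subset_closure ⟨_, m.2⟩
    | add _ _ h h' => exact add_mem h h'
  refine elim hA0 hA fun M _ _ _ _ F => ?_
  refine F.tot fun T _ _ _ _ G σ h1 h2 h3 h4 => ?_
  refine elim hB0 hB fun M' _ _ _ _ F' => ?_
  refine F'.tot fun T' _ _ _ _ G' _ _ _ _ _ => ?_
  let ρ : (A ⊗[k] B) →ₐ[k] Module.End k (T ⊗[k] T') :=
    (Module.endTensorEndAlgHom (R := k) (S := k) (A := k) (M := T) (N := T')).comp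
      (Algebra.TensorProduct.map (Algebra.lsmul k k T) (Algebra.lsmul k k T'))
  let _ : Module (A ⊗[k] B) (T ⊗[k] T') := Module.compHom _ ρ.toRingHom
  have hρ : ∀ (r : A ⊗[k] B) (t : T ⊗[k] T'), r • t = ρ r t := fun _ _ => rfl
  have : IsScalarTower k (A ⊗[k] B) (T ⊗[k] T') := ⟨fun c r t => by
    rw [hρ, hρ, map_smul, LinearMap.smul_apply]⟩
  exact Tot.tensor (fun a b m n => rfl) hAc hBc G σ h1 h2 h3 h4 G'

end
end EpsAux

open TensorProduct in
/-- Let `A` and `B` be connected `ℕ`-graded `k`-algebras such that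
`A ⊗_k B` is noetherian.  Then the following are equivalent: (i) `A ⊗_k B` with its
`ℤ²`-grading satisfies the ε-condition; (ii) `A ⊗_k B` with the total-degree
`ℤ`-grading satisfies the ε-condition; (iii) both `A` and `B` satisfy the
ε-condition. -/
theorem eps_condition_tensor
    (k : Type) [Field k] (A B : Type) [Ring A] [Algebra k A] [Ring B] [Algebra k B]
    (𝒜 : ℤ → Submodule k A) [GradedAlgebra 𝒜]
    (ℬ : ℤ → Submodule k B) [GradedAlgebra ℬ]
    -- `A` and `B` are connected and `ℕ`-graded
    (hconnA : 𝒜 0 = Submodule.span k {(1 : A)})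
    (hposA : ∀ n : ℤ, n < 0 → 𝒜 n = ⊥)
    (hconnB : ℬ 0 = Submodule.span k {(1 : B)})
    (hposB : ∀ n : ℤ, n < 0 → ℬ n = ⊥)
    -- `A ⊗_k B` is noetherian
    [IsNoetherianRing (A ⊗[k] B)] :
    -- the `ℤ²`-grading on `A ⊗_k B`
    (EpsCondition k (A ⊗[k] B)
        (fun p : ℤ × ℤ => Submodule.span k
          {x : A ⊗[k] B | ∃ a ∈ 𝒜 p.1, ∃ b ∈ ℬ p.2, x = a ⊗ₜ[k] b}) ↔
      -- the total-degree `ℤ`-grading on `A ⊗_k B`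
      EpsCondition k (A ⊗[k] B)
        (fun n : ℤ => Submodule.span k
          {x : A ⊗[k] B | ∃ i j : ℤ, i + j = n ∧ ∃ a ∈ 𝒜 i, ∃ b ∈ ℬ j,
            x = a ⊗ₜ[k] b})) ∧
    (EpsCondition k (A ⊗[k] B)
        (fun n : ℤ => Submodule.span k
          {x : A ⊗[k] B | ∃ i j : ℤ, i + j = n ∧ ∃ a ∈ 𝒜 i, ∃ b ∈ ℬ j,
            x = a ⊗ₜ[k] b}) ↔
      (EpsCondition k A 𝒜 ∧ EpsCondition k B ℬ)) := by
  have h12 : EpsCondition k (A ⊗[k] B)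
        (fun p : ℤ × ℤ => Submodule.span k
          {x : A ⊗[k] B | ∃ a ∈ 𝒜 p.1, ∃ b ∈ ℬ p.2, x = a ⊗ₜ[k] b}) →
      EpsCondition k (A ⊗[k] B)
        (fun n : ℤ => Submodule.span k
          {x : A ⊗[k] B | ∃ i j : ℤ, i + j = n ∧ ∃ a ∈ 𝒜 i, ∃ b ∈ ℬ j,
            x = a ⊗ₜ[k] b}) := by
    refine EpsAux.one_to_two (AddMonoidHom.coprod (AddMonoidHom.id ℤ) (AddMonoidHom.id ℤ)) ?_ ?_
    · intro c
      refine Submodule.subset_span ⟨algebraMap k A c, ?_, 1, SetLike.GradedOne.one_mem, rfl⟩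
      rw [Algebra.algebraMap_eq_smul_one]
      exact Submodule.smul_mem _ _ SetLike.GradedOne.one_mem
    · intro n
      refine Submodule.span_mono ?_
      rintro _ ⟨i, j, rfl, a, ha, b, hb, rfl⟩
      exact ⟨(i, j), rfl, Submodule.subset_span ⟨a, ha, b, hb, rfl⟩⟩
  have h23 : EpsCondition k (A ⊗[k] B)
        (fun n : ℤ => Submodule.span k
          {x : A ⊗[k] B | ∃ i j : ℤ, i + j = n ∧ ∃ a ∈ 𝒜 i, ∃ b ∈ ℬ j,
            x = a ⊗ₜ[k] b}) → (EpsCondition k A 𝒜 ∧ EpsCondition k B ℬ) :=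
    EpsAux.two_three 𝒜 ℬ hconnA hposA hconnB hposB _
      (fun i j a ha b hb => Submodule.subset_span ⟨i, j, rfl, a, ha, b, hb, rfl⟩)
  have h31 := fun h : EpsCondition k A 𝒜 ∧ EpsCondition k B ℬ =>
    EpsAux.three_one 𝒜 ℬ h.1 h.2
  exact ⟨⟨h12, fun h => h31 (h23 h)⟩, ⟨h23, fun h => h12 (h31 h)⟩⟩
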